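/- arXiv:1306.1998 — 3 statements merged into one kernel-verified Lean document; each statement's English description precedes it below -/
import Mathlib

section
/- Let H ∈ (0,1) and T > 0. There exists a constant C > 0, independent of x and u, such that for every x ∈ (0, 1) and all sufficiently large u, P( max_{τ ∈ [0, x], s ∈ [0, T]} Z_H(τ, s) > u ) ≤ C · T · u^{2/H − 1} · exp( −u² / (2 x^{2H}) ). -/
open MeasureTheory ProbabilityTheory Real Filter Set

/-- Tail `Ψ(u) = P(N > u)` of a standard normal random variable. -/
noncomputable def stdNormalTail (u : ℝ) : ℝ :=
  ((ProbabilityTheory.gaussianReal 0 1) (Set.Ioi u)).toReal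

theorem gaussian_tail {Ω : Type*} [MeasurableSpace Ω] (μ : Measure Ω) [IsProbabilityMeasure μ]
    {Y : Ω → ℝ} (hY : Measurable Y) {v : NNReal} (h : μ.map Y = gaussianReal 0 v) (c : ℝ) :
    μ.real {ω | c ≤ Y ω} ≤ exp (-c + (∫ ω, Y ω ^ 2 ∂μ) / 2) := by
  have hv : ∫ ω, Y ω ^ 2 ∂μ = v := by
    have h1 : ∫ y, y ^ 2 ∂(μ.map Y) = ∫ ω, Y ω ^ 2 ∂μ :=
      integral_map hY.aemeasurable (by fun_prop)
    rw [← h1, h, ← variance_id_gaussianReal (μ := 0) (v := v),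
      variance_of_integral_eq_zero (by fun_prop) (by simp)]
    simp
  have h_int : Integrable (fun ω => exp (1 * Y ω)) μ := by
    have := integrable_exp_mul_gaussianReal (μ := 0) (v := v) 1
    rw [← h] at this
    exact this.comp_measurable hY
  have := measure_ge_le_exp_mul_mgf (μ := μ) (X := Y) c zero_le_one h_int
  rw [mgf_gaussianReal h] at this
  rw [hv, exp_add]
  simpa using this

theorem memLp_two_of_gaussian {Ω : Type*} [MeasurableSpace Ω] (μ : Measure Ω)
    {Y : Ω → ℝ} (hY : Measurable Y) {v : NNReal} (h : μ.map Y = gaussianReal 0 v) :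
    MemLp Y 2 μ := by
  have := memLp_id_gaussianReal (μ := 0) (v := v) 2
  rw [← h] at this
  exact (memLp_map_measure_iff (by fun_prop) hY.aemeasurable).1 this

theorem sum_geometric_exp_le {z : ℝ} (hz : 0 < z) (n : ℕ) :
    ∑ j ∈ Finset.range n, exp (-(z * j)) ≤ 1 + 1 / z := by
  have h1 : exp (-z) < 1 := by simpa using hz
  have h2 : ∀ j : ℕ, exp (-(z * j)) = exp (-z) ^ j := fun j => by
    rw [← exp_nat_mul]; congr 1; ring
  simp_rw [h2]
  refine ((summable_geometric_of_lt_one (exp_pos _).le h1).sum_le_tsum _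
    fun _ _ => by positivity).trans ?_
  rw [tsum_geometric_of_lt_one (exp_pos _).le h1]
  have h3 : exp (-z) ≤ 1 / (1 + z) := by
    rw [exp_neg, ← one_div]
    exact one_div_le_one_div_of_le (by positivity) (by linarith [add_one_le_exp z])
  have h4 : z / (1 + z) ≤ 1 - exp (-z) := by
    have : z / (1 + z) = 1 - 1 / (1 + z) := by field_simp; ring
    linarith
  calc (1 - exp (-z))⁻¹ ≤ (z / (1 + z))⁻¹ := inv_anti₀ (by positivity) h4
    _ = 1 + 1 / z := by field_simp; ring

theorem summable_pow_mul_exp_neg_pow {a r : ℝ} (ha : 0 < a) (hr : 1 < r) :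
    Summable fun k : ℕ => a ^ k * exp (-r ^ k) := by
  obtain ⟨n, hn⟩ := pow_unbounded_of_one_lt a hr
  have hr0 : 0 < r := by linarith
  refine Summable.of_nonneg_of_le (fun k => by positivity) (fun k => ?_)
    ((summable_geometric_of_lt_one (r := a / r ^ n) (by positivity)
      ((div_lt_one (by positivity)).2 hn)).mul_left (n.factorial : ℝ))
  have h := Real.pow_div_factorial_le_exp (r ^ k) (by positivity) n
  have hf : (0 : ℝ) < n.factorial := by positivity
  have h2 : exp (-r ^ k) ≤ n.factorial / (r ^ k) ^ n := by
    rw [exp_neg, ← inv_div]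
    exact inv_anti₀ (by positivity) h
  calc a ^ k * exp (-r ^ k) ≤ a ^ k * (n.factorial / (r ^ k) ^ n) := by gcongr
    _ = n.factorial * (a / r ^ n) ^ k := by rw [div_pow, ← pow_mul, ← pow_mul, mul_comm k n]; ring

theorem exists_linear_le_rpow_sub_rpow {p x : ℝ} (hp : 0 < p) (hx : 0 < x) :
    ∃ m : ℝ, 0 < m ∧ ∀ y, 0 ≤ y → y ≤ x → m * y ≤ x ^ p - (x - y) ^ p := by
  refine ⟨min p 1 * (x ^ p / x), by positivity, fun y hy hyx => ?_⟩
  have ht : 0 ≤ 1 - y / x := by rw [sub_nonneg, div_le_one hx]; exact hyx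
  have ht' : 1 - y / x ≤ 1 := by have : 0 ≤ y / x := by positivity
                                 linarith
  have key : (1 - y / x) ^ p ≤ 1 - min p 1 * (y / x) := by
    rcases le_total p 1 with h | h
    · rw [min_eq_left h]
      have := rpow_one_add_le_one_add_mul_self (s := -(y / x)) (by linarith) hp.le h
      simpa [sub_eq_add_neg] using this
    · rw [min_eq_right h]
      simpa using rpow_le_rpow_of_exponent_ge' ht ht' zero_le_one h
  have e : (x - y) ^ p = x ^ p * (1 - y / x) ^ p := by
    rw [← mul_rpow hx.le ht]; congr 1; field_simp
  rw [e]
  have := mul_le_mul_of_nonneg_left key (rpow_nonneg hx.le p)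
  have e2 : min p 1 * (x ^ p / x) * y = x ^ p * (min p 1 * (y / x)) := by ring
  rw [e2]; linarith

theorem half_mul_two_mul_bounds (i : ℕ) {δ : ℝ} (hδ : 0 ≤ δ) :
    0 ≤ i * δ - (i / 2 : ℕ) * (2 * δ) ∧ i * δ - (i / 2 : ℕ) * (2 * δ) ≤ δ := by
  have h1 : ((i / 2 : ℕ) : ℝ) * 2 ≤ i := by exact_mod_cast Nat.div_mul_le_self i 2
  have h2 : (i : ℝ) ≤ (i / 2 : ℕ) * 2 + 1 := by
    have : i ≤ i / 2 * 2 + 1 := by omega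
    exact_mod_cast this
  constructor <;> nlinarith

theorem exists_upcrossing_level {a q : ℕ → ℝ} (h : ∃ k, q k < a k) :
    ∃ k, q k < a k ∧ (k ≠ 0 → q k - q (k - 1) < a k - a (k - 1)) := by
  classical
  refine ⟨Nat.find h, Nat.find_spec h, fun hk => ?_⟩
  have h1 := Nat.find_spec h
  have h2 := Nat.find_min h (Nat.sub_lt (Nat.pos_of_ne_zero hk) one_pos)
  linarith [not_lt.1 h2]

theorem tendsto_floor_div_mul_dyadic {s D : ℝ} (hs : 0 ≤ s) (hD : 0 < D) :
    Tendsto (fun k : ℕ => (⌊s / (D / 2 ^ k)⌋₊ : ℝ) * (D / 2 ^ k)) atTop (nhds s) := by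
  have h := (tendsto_nat_floor_mul_div_atTop (R := ℝ) (a := s / D) (by positivity)).comp
    (tendsto_pow_atTop_atTop_of_one_lt (one_lt_two (α := ℝ)))
  have h2 := h.mul_const D
  rw [div_mul_cancel₀ _ hD.ne'] at h2
  refine h2.congr fun k => ?_
  have : s / (D / 2 ^ k) = s / D * 2 ^ k := by field_simp
  simp only [Function.comp, this]
  ring

theorem floor_div_dyadic_pred (s D : ℝ) {k : ℕ} (hk : k ≠ 0) :
    ⌊s / (D / 2 ^ (k - 1))⌋₊ = ⌊s / (D / 2 ^ k)⌋₊ / 2 := by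
  rw [← Nat.floor_div_natCast]
  obtain ⟨n, rfl⟩ := Nat.exists_eq_succ_of_ne_zero hk
  congr 1
  simp only [Nat.succ_eq_add_one, Nat.add_sub_cancel, pow_succ]
  push_cast
  field_simp

section
variable {Ω : Type*} {B : ℝ → Ω → ℝ}

/-- The event that the increment field exceeds `q` at the grid point `(i * δ, x - j * δ)` and, if
`p` holds, that it moreover exceeds by `b` its value at the parent point in the grid of
mesh `2 * δ`. -/
def gridEvent (B : ℝ → Ω → ℝ) (x q b δ : ℝ) (p : Prop) (i j : ℕ) : Set Ω :=
  {ω | q < B (i * δ + (x - j * δ)) ω - B (i * δ) ω ∧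
    (p → b < (B (i * δ + (x - j * δ)) ω - B (i * δ) ω) -
      (B ((i / 2 : ℕ) * (2 * δ) + (x - (j / 2 : ℕ) * (2 * δ))) ω - B ((i / 2 : ℕ) * (2 * δ)) ω))}

theorem exists_mem_gridEvent {x T u D : ℝ} {q b : ℕ → ℝ} (hD : 0 < D)
    (hq : ∀ k, q k ≤ u) (hb : ∀ k, k ≠ 0 → b k = q k - q (k - 1)) {ω : Ω}
    (hcont : Continuous fun t => B t ω) {s τ : ℝ} (hs : s ∈ Set.Icc 0 T) (hτ : τ ∈ Set.Icc 0 x)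
    (h : u < B (s + τ) ω - B s ω) :
    ∃ k : ℕ, ∃ i ∈ Finset.range (⌊T / (D / 2 ^ k)⌋₊ + 1),
      ∃ j ∈ Finset.range (⌊x / (D / 2 ^ k)⌋₊ + 1),
        ω ∈ gridEvent B x (q k) (b k) (D / 2 ^ k) (k ≠ 0) i j := by
  have hx : 0 ≤ x - τ := by linarith [hτ.2]
  let S : ℕ → ℝ := fun k => (⌊s / (D / 2 ^ k)⌋₊ : ℝ) * (D / 2 ^ k)
  let R : ℕ → ℝ := fun k => x - (⌊(x - τ) / (D / 2 ^ k)⌋₊ : ℝ) * (D / 2 ^ k)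
  have hS : Tendsto S atTop (nhds s) := tendsto_floor_div_mul_dyadic hs.1 hD
  have hR : Tendsto R atTop (nhds τ) := by
    simpa using (tendsto_floor_div_mul_dyadic hx hD).const_sub x
  have hZ : Tendsto (fun k => B (S k + R k) ω - B (S k) ω) atTop (nhds (B (s + τ) ω - B s ω)) :=
    ((hcont.tendsto _).comp (hS.add hR)).sub ((hcont.tendsto _).comp hS)
  obtain ⟨k₀, hk₀⟩ := (hZ.eventually (lt_mem_nhds h)).exists
  obtain ⟨k, hk1, hk2⟩ := exists_upcrossing_level (q := q)
    (a := fun k => B (S k + R k) ω - B (S k) ω) ⟨k₀, (hq k₀).trans_lt hk₀⟩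
  have hd : 0 < D / 2 ^ k := by positivity
  refine ⟨k, ⌊s / (D / 2 ^ k)⌋₊, ?_, ⌊(x - τ) / (D / 2 ^ k)⌋₊, ?_, hk1, fun hk => ?_⟩
  · rw [Finset.mem_range, Nat.lt_add_one_iff]
    have := hs.2
    gcongr
  · rw [Finset.mem_range, Nat.lt_add_one_iff]
    have := hτ.1
    gcongr
    linarith
  · have h3 := hk2 hk
    have e : D / 2 ^ (k - 1) = 2 * (D / 2 ^ k) := by
      obtain ⟨n, rfl⟩ := Nat.exists_eq_succ_of_ne_zero hk
      simp only [Nat.succ_eq_add_one, Nat.add_sub_cancel, pow_succ]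
      field_simp
    simp only [S, R, floor_div_dyadic_pred _ D hk] at h3
    rw [e] at h3
    rw [hb k hk]
    exact h3

end

section
variable {Ω : Type*} [MeasurableSpace Ω] {μ : Measure Ω} {H : ℝ} {B : ℝ → Ω → ℝ}

theorem memLp_two_fbm (hmeas : ∀ t : ℝ, Measurable (B t))
    (hgauss : ∀ (n : ℕ) (c : Fin n → ℝ) (t : Fin n → ℝ),
      ∃ v : NNReal, μ.map (fun ω => ∑ i, c i * B (t i) ω) = gaussianReal 0 v) (t : ℝ) :
    MemLp (B t) 2 μ := by
  obtain ⟨v, hv⟩ := hgauss 1 (fun _ => 1) (fun _ => t)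
  exact memLp_two_of_gaussian μ (hmeas t) (by simpa using hv)

theorem integral_sq_increment_fbm (hH : 0 < H) (hL : ∀ t, MemLp (B t) 2 μ)
    (hcov : ∀ t s : ℝ, 0 ≤ t → 0 ≤ s →
      ∫ ω, B t ω * B s ω ∂μ = (t ^ (2 * H) + s ^ (2 * H) - |t - s| ^ (2 * H)) / 2)
    {t s : ℝ} (ht : 0 ≤ t) (hs : 0 ≤ s) :
    ∫ ω, (B t ω - B s ω) ^ 2 ∂μ = |t - s| ^ (2 * H) := by
  have e : ∀ ω, (B t ω - B s ω) ^ 2 = B t ω * B t ω - 2 * (B t ω * B s ω) + B s ω * B s ω :=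
    fun ω => by ring
  have i1 : ∀ a b, Integrable (fun ω => B a ω * B b ω) μ := fun a b => (hL a).integrable_mul (hL b)
  have i2 : Integrable (fun ω => B t ω * B t ω - 2 * (B t ω * B s ω)) μ :=
    (i1 t t).sub ((i1 t s).const_mul 2)
  simp_rw [e]
  rw [integral_add i2 (i1 s s),
    integral_sub (i1 t t) ((i1 t s).const_mul 2), integral_const_mul, hcov t t ht ht,
    hcov t s ht hs, hcov s s hs hs]
  have : (0 : ℝ) ^ (2 * H) = 0 := zero_rpow (by positivity)
  simp only [sub_self, abs_zero, this]
  ring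

theorem fbm_joint_tail [IsProbabilityMeasure μ] (hH : 0 < H)
    (hmeas : ∀ t : ℝ, Measurable (B t))
    (hgauss : ∀ (n : ℕ) (c : Fin n → ℝ) (t : Fin n → ℝ),
      ∃ v : NNReal, μ.map (fun ω => ∑ i, c i * B (t i) ω) = gaussianReal 0 v)
    (hcov : ∀ t s : ℝ, 0 ≤ t → 0 ≤ s →
      ∫ ω, B t ω * B s ω ∂μ = (t ^ (2 * H) + s ^ (2 * H) - |t - s| ^ (2 * H)) / 2)
    {s τ s' τ' δ l θ : ℝ} (hs : 0 ≤ s) (hτ : 0 ≤ τ) (hs' : 0 ≤ s') (hτ' : τ ≤ τ')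
    (h1 : |s - s'| ≤ δ) (h2 : |(s + τ) - (s' + τ')| ≤ δ) (hl : 0 ≤ l) (hθ : 0 ≤ θ) (c : ℝ) :
    μ.real {ω | c ≤ l * (B (s + τ) ω - B s ω) +
        θ * ((B (s + τ) ω - B s ω) - (B (s' + τ') ω - B s' ω))} ≤
      exp (-c + (l ^ 2 * τ ^ (2 * H) + 4 * (l * θ + θ ^ 2) * δ ^ (2 * H)) / 2) := by
  have hL := memLp_two_fbm hmeas hgauss
  have hI : ∀ a b, Integrable (fun ω => (B a ω - B b ω) ^ 2) μ :=
    fun a b => ((hL a).sub (hL b)).integrable_sq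
  have hV : ∀ {a b : ℝ}, 0 ≤ a → 0 ≤ b → ∫ ω, (B a ω - B b ω) ^ 2 ∂μ = |a - b| ^ (2 * H) :=
    integral_sq_increment_fbm hH hL hcov
  obtain ⟨v, hv⟩ := hgauss 4 ![l + θ, -(l + θ), -θ, θ] ![s + τ, s, s' + τ', s']
  have hY : (fun ω => l * (B (s + τ) ω - B s ω) +
        θ * ((B (s + τ) ω - B s ω) - (B (s' + τ') ω - B s' ω))) =
      fun ω => ∑ i, (![l + θ, -(l + θ), -θ, θ] : Fin 4 → ℝ) i *
        B ((![s + τ, s, s' + τ', s'] : Fin 4 → ℝ) i) ω := by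
    funext ω
    simp [Fin.sum_univ_four]
    ring
  rw [← hY] at hv
  refine (gaussian_tail μ (by fun_prop) hv c).trans ?_
  gcongr
  have hq : 0 ≤ 2 * (l * θ + θ ^ 2) := by positivity
  have h_int := ((((hI (s + τ) s).const_mul (l ^ 2 + l * θ)).sub
    ((hI (s' + τ') s').const_mul (l * θ))).add
    (((hI (s + τ) (s' + τ')).add (hI s s')).const_mul (2 * (l * θ + θ ^ 2))))
  calc _ ≤ ∫ ω, ((l ^ 2 + l * θ) * (B (s + τ) ω - B s ω) ^ 2
          - l * θ * (B (s' + τ') ω - B s' ω) ^ 2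
          + 2 * (l * θ + θ ^ 2) * ((B (s + τ) ω - B (s' + τ') ω) ^ 2 + (B s ω - B s' ω) ^ 2)) ∂μ := by
        refine integral_mono_of_nonneg (ae_of_all _ fun ω => sq_nonneg _) h_int
          (ae_of_all _ fun ω => ?_)
        have := mul_nonneg (add_nonneg (mul_nonneg hl hθ) (sq_nonneg θ))
          (sq_nonneg (B (s + τ) ω - B (s' + τ') ω + (B s ω - B s' ω)))
        simp only
        linarith
    _ = (l ^ 2 + l * θ) * τ ^ (2 * H) - l * θ * τ' ^ (2 * H) + 2 * (l * θ + θ ^ 2) *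
          (|s + τ - (s' + τ')| ^ (2 * H) + |s - s'| ^ (2 * H)) := by
        rw [integral_add, integral_sub, integral_const_mul, integral_const_mul,
          integral_const_mul, integral_add (hI _ _) (hI _ _), hV, hV, hV, hV]
        · simp [abs_of_nonneg hτ, abs_of_nonneg (hτ.trans hτ')]
        all_goals try linarith
        · exact (hI _ _).const_mul _
        · exact (hI _ _).const_mul _
        · exact ((hI _ _).const_mul _).sub ((hI _ _).const_mul _)
        · exact ((hI _ _).add (hI _ _)).const_mul _
    _ ≤ (l ^ 2 + l * θ) * τ ^ (2 * H) - l * θ * τ ^ (2 * H) + 2 * (l * θ + θ ^ 2) *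
          (δ ^ (2 * H) + δ ^ (2 * H)) := by
        gcongr
    _ = _ := by ring

theorem gridEvent_tail [IsProbabilityMeasure μ] (hH : 0 < H)
    (hmeas : ∀ t : ℝ, Measurable (B t))
    (hgauss : ∀ (n : ℕ) (c : Fin n → ℝ) (t : Fin n → ℝ),
      ∃ v : NNReal, μ.map (fun ω => ∑ i, c i * B (t i) ω) = gaussianReal 0 v)
    (hcov : ∀ t s : ℝ, 0 ≤ t → 0 ≤ s →
      ∫ ω, B t ω * B s ω ∂μ = (t ^ (2 * H) + s ^ (2 * H) - |t - s| ^ (2 * H)) / 2)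
    {x q b δ l θ : ℝ} {p : Prop} {i j : ℕ} (hδ : 0 ≤ δ) (hj : j * δ ≤ x) (hl : 0 ≤ l)
    (hθ : 0 ≤ θ) (hp : ¬ p → θ = 0) :
    μ.real (gridEvent B x q b δ p i j) ≤
      exp (-(l * q + θ * b) +
        (l ^ 2 * (x - j * δ) ^ (2 * H) + 4 * (l * θ + θ ^ 2) * δ ^ (2 * H)) / 2) := by
  obtain ⟨hi1, hi2⟩ := half_mul_two_mul_bounds i hδ
  obtain ⟨hj1, hj2⟩ := half_mul_two_mul_bounds j hδ
  refine le_trans (measureReal_mono ?_) (fbm_joint_tail (s := i * δ) (τ := x - j * δ)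
    (s' := (i / 2 : ℕ) * (2 * δ)) (τ' := x - (j / 2 : ℕ) * (2 * δ)) hH hmeas hgauss hcov
    (by positivity) (by linarith) (by positivity) (by linarith)
    (abs_le.2 ⟨by linarith, hi2⟩) (abs_le.2 ⟨by linarith, by linarith⟩) hl hθ _)
  rintro ω ⟨h1, h2⟩
  refine add_le_add (mul_le_mul_of_nonneg_left h1.le hl) ?_
  by_cases h : p
  · exact mul_le_mul_of_nonneg_left (h2 h).le hθ
  · simp [hp h]

theorem gridEvent_bound [IsProbabilityMeasure μ] (hH : 0 < H)
    (hmeas : ∀ t : ℝ, Measurable (B t))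
    (hgauss : ∀ (n : ℕ) (c : Fin n → ℝ) (t : Fin n → ℝ),
      ∃ v : NNReal, μ.map (fun ω => ∑ i, c i * B (t i) ω) = gaussianReal 0 v)
    (hcov : ∀ t s : ℝ, 0 ≤ t → 0 ≤ s →
      ∫ ω, B t ω * B s ω ∂μ = (t ^ (2 * H) + s ^ (2 * H) - |t - s| ^ (2 * H)) / 2)
    {x δ u R V m c : ℝ} {p : Prop} {i j : ℕ} (hδ : 0 ≤ δ) (hj : j * δ ≤ x) (hu : 0 < u)
    (hR : 1 ≤ R) (hp : ¬ p → R = 1) (hV : 0 < V) (hc : 0 ≤ c)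
    (hm : m * (j * δ) ≤ V - (x - j * δ) ^ (2 * H)) (hδR : δ ^ (2 * H) = 1 / (u ^ 2 * R ^ 4)) :
    μ.real (gridEvent B x (u - c / (u * R)) (1 / (u * R)) δ p i j) ≤
      exp (-(u ^ 2) / (2 * V)) * exp (c / V + 2 / V + 3) * exp (-R) *
        exp (-(u ^ 2 * m * δ / (2 * V ^ 2) * j)) := by
  have hR0 : 0 < R := by linarith
  have hRi : R⁻¹ ≤ 1 := inv_le_one_of_one_le₀ hR
  have hVi : 0 < V⁻¹ := inv_pos.2 hV
  have hvar : (u / V) ^ 2 * (x - j * δ) ^ (2 * H) / 2 ≤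
      u ^ 2 / (2 * V) - u ^ 2 * m * δ / (2 * V ^ 2) * j := by
    have : (u / V) ^ 2 * (x - j * δ) ^ (2 * H) / 2 ≤ (u / V) ^ 2 * (V - m * (j * δ)) / 2 := by
      gcongr; linarith
    refine this.trans (le_of_eq ?_)
    field_simp
  have hq : -(u / V * (u - c / (u * R))) ≤ -(u ^ 2 / V) + c / V := by
    have e : u / V * (u - c / (u * R)) = u ^ 2 / V - c * V⁻¹ * R⁻¹ := by field_simp
    have : c * V⁻¹ * R⁻¹ ≤ c * V⁻¹ * 1 := by gcongr
    rw [e, div_eq_mul_inv c V]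
    linarith
  have e2 : u ^ 2 / V = 2 * (u ^ 2 / (2 * V)) := by field_simp
  rw [← exp_add, ← exp_add, ← exp_add]
  by_cases h : p
  · refine (gridEvent_tail (l := u / V) (θ := u * R ^ 2) hH hmeas hgauss hcov hδ hj
      (by positivity) (by positivity) (fun h' => absurd h h')).trans ?_
    rw [hδR, exp_le_exp]
    have e1 : u * R ^ 2 * (1 / (u * R)) = R := by field_simp
    have e3 : 4 * (u / V * (u * R ^ 2) + (u * R ^ 2) ^ 2) * (1 / (u ^ 2 * R ^ 4)) / 2 =
        2 * V⁻¹ * (R⁻¹ * R⁻¹) + 2 := by field_simp; ring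
    have e4 : 2 * V⁻¹ * (R⁻¹ * R⁻¹) ≤ 2 * V⁻¹ * (1 * 1) := by gcongr
    rw [e1, add_div, e3, neg_div, div_eq_mul_inv 2 V]
    linarith
  · refine (gridEvent_tail (l := u / V) (θ := 0) hH hmeas hgauss hcov hδ hj
      (by positivity) le_rfl (fun _ => rfl)).trans ?_
    rw [exp_le_exp, hp h] at *
    have : 0 < 2 / V := by positivity
    simp only [mul_zero, zero_mul, add_zero, zero_pow two_ne_zero, neg_div]
    linarith

theorem measureReal_gridLevel_le [IsProbabilityMeasure μ] (hH : 0 < H)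
    (hmeas : ∀ t : ℝ, Measurable (B t))
    (hgauss : ∀ (n : ℕ) (c : Fin n → ℝ) (t : Fin n → ℝ),
      ∃ v : NNReal, μ.map (fun ω => ∑ i, c i * B (t i) ω) = gaussianReal 0 v)
    (hcov : ∀ t s : ℝ, 0 ≤ t → 0 ≤ s →
      ∫ ω, B t ω * B s ω ∂μ = (t ^ (2 * H) + s ^ (2 * H) - |t - s| ^ (2 * H)) / 2)
    {x T D u r m c : ℝ} (hx : 0 < x) (hD : 0 < D) (hDT : D ≤ T) (hu : 0 < u) (hr : 1 ≤ r)
    (hc : 0 ≤ c) (hm0 : 0 < m)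
    (hm : ∀ y, 0 ≤ y → y ≤ x → m * y ≤ x ^ (2 * H) - (x - y) ^ (2 * H)) (k : ℕ)
    (hδ : (D / 2 ^ k) ^ (2 * H) = 1 / (u ^ 2 * (r ^ k) ^ 4)) :
    μ.real (⋃ i ∈ Finset.range (⌊T / (D / 2 ^ k)⌋₊ + 1),
      ⋃ j ∈ Finset.range (⌊x / (D / 2 ^ k)⌋₊ + 1),
        gridEvent B x (u - c / (u * r ^ k)) (1 / (u * r ^ k)) (D / 2 ^ k) (k ≠ 0) i j) ≤
      exp (-(u ^ 2) / (2 * x ^ (2 * H))) * exp (c / x ^ (2 * H) + 2 / x ^ (2 * H) + 3) *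
        (2 * T / D) * (1 + 1 / (u ^ 2 * m * D / (2 * (x ^ (2 * H)) ^ 2))) *
        (4 ^ k * exp (-r ^ k)) := by
  set V := x ^ (2 * H)
  have hV : 0 < V := by positivity
  set A := exp (-(u ^ 2) / (2 * V)) * exp (c / V + 2 / V + 3) with hA
  have hd : 0 < D / 2 ^ k := by positivity
  have hT : 0 < T := hD.trans_le hDT
  set z := u ^ 2 * m * D / (2 * V ^ 2) with hz
  have hz0 : 0 < z := by positivity
  have hzk : u ^ 2 * m * (D / 2 ^ k) / (2 * V ^ 2) = z / 2 ^ k := by rw [hz]; ring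
  have h2k : (1 : ℝ) ≤ 2 ^ k := one_le_pow₀ one_le_two
  have hrow : ∀ i, μ.real (⋃ j ∈ Finset.range (⌊x / (D / 2 ^ k)⌋₊ + 1),
      gridEvent B x (u - c / (u * r ^ k)) (1 / (u * r ^ k)) (D / 2 ^ k) (k ≠ 0) i j) ≤
      A * exp (-r ^ k) * (2 ^ k * (1 + 1 / z)) := by
    intro i
    calc _ ≤ ∑ j ∈ Finset.range (⌊x / (D / 2 ^ k)⌋₊ + 1),
          A * exp (-r ^ k) * exp (-(z / 2 ^ k * j)) := by
          refine (measureReal_biUnion_finset_le _ _).trans (Finset.sum_le_sum fun j hj => ?_)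
          have hj' : j * (D / 2 ^ k) ≤ x := by
            rw [← le_div_iff₀ hd]
            exact (Nat.cast_le.2 (Nat.lt_add_one_iff.1 (Finset.mem_range.1 hj))).trans
              (Nat.floor_le (by positivity))
          rw [hA, ← hzk]
          exact gridEvent_bound hH hmeas hgauss hcov hd.le hj' hu (one_le_pow₀ hr)
            (fun h => by simp [not_not.1 h]) hV hc (hm _ (by positivity) hj') hδ
      _ ≤ A * exp (-r ^ k) * (1 + 1 / (z / 2 ^ k)) := by
          rw [← Finset.mul_sum]
          gcongr
          exact sum_geometric_exp_le (by positivity) _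
      _ ≤ _ := by
          gcongr
          have e : 1 / (z / 2 ^ k) = 2 ^ k * (1 / z) := by field_simp
          rw [e, mul_add]
          linarith
  calc _ ≤ ∑ i ∈ Finset.range (⌊T / (D / 2 ^ k)⌋₊ + 1),
        A * exp (-r ^ k) * (2 ^ k * (1 + 1 / z)) :=
        (measureReal_biUnion_finset_le _ _).trans (Finset.sum_le_sum fun i _ => hrow i)
    _ = (⌊T / (D / 2 ^ k)⌋₊ + 1 : ℝ) * (A * exp (-r ^ k) * (2 ^ k * (1 + 1 / z))) := by simp
    _ ≤ (2 * T / D * 2 ^ k) * (A * exp (-r ^ k) * (2 ^ k * (1 + 1 / z))) := by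
        gcongr
        have h1 : (⌊T / (D / 2 ^ k)⌋₊ : ℝ) ≤ T / (D / 2 ^ k) := Nat.floor_le (by positivity)
        have h2 : T / (D / 2 ^ k) = T / D * 2 ^ k := by field_simp
        have h3 : 1 ≤ T / D * 2 ^ k :=
          one_le_mul_of_one_le_of_one_le ((one_le_div hD).2 hDT) h2k
        have h4 : 2 * T / D * 2 ^ k = T / D * 2 ^ k + T / D * 2 ^ k := by ring
        linarith
    _ = _ := by
        have : (4 : ℝ) ^ k = 2 ^ k * 2 ^ k := by rw [← mul_pow]; norm_num
        rw [this]; ring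

theorem toReal_measure_le_of_subset_iUnion [IsFiniteMeasure μ] {s : Set Ω} {t : ℕ → Set Ω}
    {w : ℕ → ℝ} (hs : ∀ᵐ ω ∂μ, ω ∈ s → ω ∈ ⋃ k, t k) (hw : Summable w)
    (h : ∀ k, μ.real (t k) ≤ w k) : (μ s).toReal ≤ ∑' k, w k := by
  have hw0 : ∀ k, 0 ≤ w k := fun k => measureReal_nonneg.trans (h k)
  refine ENNReal.toReal_le_of_le_ofReal (tsum_nonneg hw0) ?_
  rw [ENNReal.ofReal_tsum_of_nonneg hw0 hw]
  refine (measure_mono_ae hs).trans ((measure_iUnion_le t).trans (ENNReal.tsum_le_tsum fun k => ?_))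
  rw [← ofReal_measureReal]
  exact ENNReal.ofReal_le_ofReal (h k)

theorem rpow_mesh_eq {u : ℝ} (hu : 0 < u) (hH : 0 < H) (k : ℕ) :
    (u ^ (-(1 / H)) / 2 ^ k) ^ (2 * H) = 1 / (u ^ 2 * (((2 : ℝ) ^ (H / 2)) ^ k) ^ 4) := by
  rw [div_rpow (by positivity) (by positivity), ← rpow_mul hu.le, ← rpow_natCast 2 k,
    ← rpow_mul zero_le_two, ← rpow_natCast _ k, ← rpow_mul zero_le_two, ← rpow_natCast _ 4,
    ← rpow_mul zero_le_two]
  have e1 : -(1 / H) * (2 * H) = -(2 : ℕ) := by push_cast; field_simp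
  have e2 : H / 2 * (k : ℝ) * (4 : ℕ) = k * (2 * H) := by push_cast; ring
  rw [e1, e2, rpow_neg hu.le, rpow_natCast, one_div, mul_inv, div_eq_mul_inv]

theorem eventually_poly_le (hH : 0 < H) (hH1 : H < 1) (K L : ℝ) :
    ∀ᶠ u : ℝ in atTop, K * u ^ (1 / H) * (1 + L * u ^ (1 / H - 2)) ≤ u ^ (2 / H - 1) := by
  have h1 : 0 < 1 / H - 1 := by rw [sub_pos, lt_div_iff₀ hH]; linarith
  have t1 := (tendsto_rpow_atTop h1).eventually_ge_atTop (2 * K)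
  filter_upwards [t1, eventually_ge_atTop (2 * (K * L)), eventually_gt_atTop 0] with u a b c
  have e1 : u ^ (2 / H - 1) = u ^ (1 / H) * u ^ (1 / H - 1) := by
    rw [← rpow_add c]; congr 1; ring
  have e2 : u ^ (1 / H - 1) = u * u ^ (1 / H - 2) := by
    nth_rw 2 [← rpow_one u]
    rw [← rpow_add c]; congr 1; ring
  have h3 : 0 < u ^ (1 / H - 2) := by positivity
  have h4 := mul_le_mul_of_nonneg_right b h3.le
  rw [e1]
  have : K * (1 + L * u ^ (1 / H - 2)) ≤ u ^ (1 / H - 1) := by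
    rw [← e2] at h4
    linarith
  calc _ = u ^ (1 / H) * (K * (1 + L * u ^ (1 / H - 2))) := by ring
    _ ≤ _ := by gcongr
end

/-- Piterbarg-type inequality: there is `C > 0` (independent of `x` and `u`) such that
for every `x ∈ (0,1)` and all large `u`,
`P(max_{τ∈[0,x], s∈[0,T]} Z_H(τ,s) > u) ≤ C T u^{2/H-1} exp(-u²/(2 x^{2H}))`. -/
theorem shepp_fbm_piterbarg_bound
    {Ω : Type*} [MeasurableSpace Ω] (μ : Measure Ω) [IsProbabilityMeasure μ]
    (H : ℝ) (hH : H ∈ Set.Ioo (0:ℝ) (1))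
    (B : ℝ → Ω → ℝ)
    (hmeas : ∀ t : ℝ, Measurable (B t))
    (hzero : ∀ ω, B 0 ω = 0)
    (hcont : ∀ᵐ ω ∂μ, Continuous fun t => B t ω)
    (hgauss : ∀ (n : ℕ) (c : Fin n → ℝ) (t : Fin n → ℝ),
      ∃ v : NNReal, μ.map (fun ω => ∑ i, c i * B (t i) ω) =
        ProbabilityTheory.gaussianReal 0 v)
    (hcov : ∀ t s : ℝ, 0 ≤ t → 0 ≤ s →
      ∫ ω, B t ω * B s ω ∂μ = (t ^ (2*H) + s ^ (2*H) - |t - s| ^ (2*H)) / 2)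
    (T : ℝ) (hT : 0 < T) :
    ∃ C : ℝ, 0 < C ∧ ∀ x ∈ Set.Ioo (0:ℝ) 1, ∀ᶠ u : ℝ in atTop,
      (μ {ω | u < ⨆ (τ : Set.Icc (0:ℝ) (x)) (s : Set.Icc (0:ℝ) (T)),
            (B ((s:ℝ) + (τ:ℝ)) ω - B (s:ℝ) ω)}).toReal ≤
        C * T * u ^ (2/H - 1) * Real.exp (-(u^2) / (2 * x ^ (2*H))) := by
  obtain ⟨hH0, hH1⟩ := hH
  refine ⟨1, one_pos, fun x hx => ?_⟩
  have hx0 : 0 < x := hx.1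
  obtain ⟨m, hm0, hm⟩ := exists_linear_le_rpow_sub_rpow (p := 2 * H) (by positivity) hx0
  set V := x ^ (2 * H) with hVdef
  have hV : 0 < V := by positivity
  set r : ℝ := 2 ^ (H / 2) with hr
  have hr1 : 1 < r := one_lt_rpow one_lt_two (by positivity)
  have hc0 : 0 < r - 1 := by linarith
  set c := 1 / (r - 1) with hc
  have hcr : c * (r - 1) = 1 := by rw [hc]; field_simp
  have hsum := summable_pow_mul_exp_neg_pow (a := 4) (by norm_num) hr1
  set S := ∑' k : ℕ, (4 : ℝ) ^ k * exp (-r ^ k)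
  have hpoly := eventually_poly_le hH0 hH1 (exp (c / V + 2 / V + 3) * 2 * S) (2 * V ^ 2 / m)
  have hmesh := (tendsto_rpow_neg_atTop (y := 1 / H) (by positivity)).eventually_le_const hT
  filter_upwards [hpoly, hmesh, eventually_gt_atTop 0] with u hu1 hDT hu
  set D := u ^ (-(1 / H)) with hD
  have hD0 : 0 < D := by positivity
  have hincl : ∀ᵐ ω ∂μ, ω ∈ {ω | u < ⨆ (τ : Set.Icc (0:ℝ) (x)) (s : Set.Icc (0:ℝ) (T)),
      (B ((s:ℝ) + (τ:ℝ)) ω - B (s:ℝ) ω)} →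
      ω ∈ ⋃ k : ℕ, ⋃ i ∈ Finset.range (⌊T / (D / 2 ^ k)⌋₊ + 1),
      ⋃ j ∈ Finset.range (⌊x / (D / 2 ^ k)⌋₊ + 1),
        gridEvent B x (u - c / (u * r ^ k)) (1 / (u * r ^ k)) (D / 2 ^ k) (k ≠ 0) i j := by
    filter_upwards [hcont] with ω hω h
    have : Nonempty (Set.Icc (0:ℝ) x) := ⟨⟨0, le_rfl, hx0.le⟩⟩
    have : Nonempty (Set.Icc (0:ℝ) T) := ⟨⟨0, le_rfl, hT.le⟩⟩
    obtain ⟨τ, hτ⟩ := exists_lt_of_lt_ciSup h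
    obtain ⟨s, hs⟩ := exists_lt_of_lt_ciSup hτ
    have hb : ∀ k : ℕ, k ≠ 0 →
        1 / (u * r ^ k) = u - c / (u * r ^ k) - (u - c / (u * r ^ (k - 1))) := fun k hk => by
      obtain ⟨n, rfl⟩ := Nat.exists_eq_succ_of_ne_zero hk
      simp only [Nat.succ_eq_add_one, Nat.add_sub_cancel, pow_succ]
      field_simp
      linarith
    obtain ⟨k, i, hi, j, hj, hω'⟩ := exists_mem_gridEvent hD0
      (fun k => sub_le_self u (by positivity)) hb hω s.2 τ.2 hs
    simp only [Set.mem_iUnion]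
    exact ⟨k, i, hi, j, hj, hω'⟩
  refine (toReal_measure_le_of_subset_iUnion hincl (hsum.mul_left _) fun k =>
    measureReal_gridLevel_le hH0 hmeas hgauss hcov hx0 hD0 hDT hu hr1.le (by positivity) hm0 hm k
      (rpow_mesh_eq hu hH0 k)).trans ?_
  rw [tsum_mul_left]
  have e1 : 1 / D = u ^ (1 / H) := by rw [hD, rpow_neg hu.le, one_div, inv_inv]
  have e2 : 1 / (u ^ 2 * m * D / (2 * V ^ 2)) = 2 * V ^ 2 / m * u ^ (1 / H - 2) := by
    rw [rpow_sub hu, ← e1, rpow_two]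
    field_simp
  rw [e2]
  calc _ = exp (-(u ^ 2) / (2 * V)) * T * (exp (c / V + 2 / V + 3) * 2 * S * u ^ (1 / H) *
        (1 + 2 * V ^ 2 / m * u ^ (1 / H - 2))) := by rw [← e1]; ring
    _ ≤ exp (-(u ^ 2) / (2 * V)) * T * u ^ (2 / H - 1) := by gcongr
    _ = _ := by ring
end

section
/- Let H ∈ (0,1) and let Y_H(t, s) = B_H(t) − B_H(s) for 0 ≤ s < t. Denote by r(t, s; t', s') the correlation coefficient of Y_H(t, s) and Y_H(t', s'). Then for every ε > 0 there exists δ > 0 such that whenever |(t − s) − 1| < δ, |(t' − s') − 1| < δ, 0 < |t − t'| + |s − s'| < δ, we have | r(t, s; t', s') − 1 + (1/2)(|t − t'|^{2H} + |s − s'|^{2H}) | ≤ ε · (1/2)(|t − t'|^{2H} + |s − s'|^{2H}); in other words, r(t, s; t', s') = 1 − (1/2)(1 + o(1))(|t − t'|^{2H} + |s − s'|^{2H}) as t − s → 1, t' − s' → 1, t − t' → 0 and s − s' → 0. -/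
open MeasureTheory ProbabilityTheory Real Filter Set

/-- The second mixed difference of a power function near `1` is `O(|x| |y|)`. -/
theorem exists_abs_rpow_mixed_difference_le (p : ℝ) :
    ∃ C r : ℝ, 0 ≤ C ∧ 0 < r ∧ ∀ b x y : ℝ, |b - 1| < r → |x| < r → |y| < r →
      |((b + x) ^ p - (b + x - y) ^ p) - (b ^ p - (b - y) ^ p)| ≤ C * |x| * |y| := by
  have hc : ContDiffAt ℝ 1 (fun z : ℝ => p * z ^ (p - 1)) 1 :=
    contDiffAt_const.mul (Real.contDiffAt_rpow_const_of_ne one_ne_zero)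
  obtain ⟨K, t, ht, hK⟩ := hc.exists_lipschitzOnWith
  obtain ⟨ρ, hρ, hρt⟩ := Metric.mem_nhds_iff.1 ht
  refine ⟨K, min ρ 1 / 3, K.2, by positivity, fun b x y hb hx hy => ?_⟩
  have hρ1 : min ρ 1 ≤ ρ := min_le_left _ _
  have hρ2 : min ρ 1 ≤ 1 := min_le_right _ _
  rw [abs_lt] at hb hx hy
  have hderiv : ∀ z ∈ Metric.ball (1 : ℝ) (2 * (min ρ 1 / 3)),
      HasDerivWithinAt (fun z : ℝ => z ^ p - (z - y) ^ p)
        (p * z ^ (p - 1) - p * (z - y) ^ (p - 1)) (Metric.ball 1 (2 * (min ρ 1 / 3))) z := by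
    intro z hz
    rw [Metric.mem_ball, Real.dist_eq, abs_lt] at hz
    have h₁ := Real.hasDerivAt_rpow_const (x := z) (p := p) (Or.inl (by linarith))
    have h₂ := (Real.hasDerivAt_rpow_const (x := z - y) (p := p)
      (Or.inl (by linarith))).comp z ((hasDerivAt_id z).sub_const y)
    rw [mul_one] at h₂
    exact (h₁.sub h₂).hasDerivWithinAt
  have hbound : ∀ z ∈ Metric.ball (1 : ℝ) (2 * (min ρ 1 / 3)),
      ‖p * z ^ (p - 1) - p * (z - y) ^ (p - 1)‖ ≤ K * |y| := by
    intro z hz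
    rw [Metric.mem_ball, Real.dist_eq, abs_lt] at hz
    have h := hK.norm_sub_le (x := z) (y := z - y)
      (hρt (by rw [Metric.mem_ball, Real.dist_eq, abs_lt]; constructor <;> linarith))
      (hρt (by rw [Metric.mem_ball, Real.dist_eq, abs_lt]; constructor <;> linarith))
    simpa using h
  have h := (convex_ball (1 : ℝ) (2 * (min ρ 1 / 3))).norm_image_sub_le_of_norm_hasDerivWithin_le
    hderiv hbound (x := b) (y := b + x)
    (by rw [Metric.mem_ball, Real.dist_eq, abs_lt]; constructor <;> linarith)
    (by rw [Metric.mem_ball, Real.dist_eq, abs_lt]; constructor <;> linarith)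
  simp only [Real.norm_eq_abs, add_sub_cancel_left] at h
  exact h.trans_eq (by ring)

/-- Replacing `(b + x) ^ (2 * H) + (b - y) ^ (2 * H)` by twice the geometric mean of `a ^ (2 * H)` and
`b ^ (2 * H)`, where `a = b + x - y`, costs an error quadratic in `x` and `y`. -/
theorem exists_abs_rpow_add_rpow_sub_le (H : ℝ) :
    ∃ M r : ℝ, 0 ≤ M ∧ 0 < r ∧ ∀ a b x y : ℝ, |a - 1| < r → |b - 1| < r → |x| < r → |y| < r →
      a - b = x - y →
      |(b + x) ^ (2 * H) + (b - y) ^ (2 * H) - 2 * (a ^ H * b ^ H)| ≤ M * (x ^ 2 + y ^ 2) := by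
  obtain ⟨C, r, hC, hr, hmixed⟩ := exists_abs_rpow_mixed_difference_le (2 * H)
  have hc : ContDiffAt ℝ 1 (fun z : ℝ => z ^ H) 1 :=
    Real.contDiffAt_rpow_const_of_ne one_ne_zero
  obtain ⟨L, u, hu, hL⟩ := hc.exists_lipschitzOnWith
  obtain ⟨ρ, hρ, hρu⟩ := Metric.mem_nhds_iff.1 hu
  refine ⟨C + 2 * (L : ℝ) ^ 2, min (min r ρ) 1, by positivity, by positivity,
    fun a b x y ha hb hx hy hab => ?_⟩
  simp only [lt_min_iff] at ha hb hx hy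
  have ha0 : 0 < a := by linarith [(abs_lt.1 ha.2).1]
  have hb0 : 0 < b := by linarith [(abs_lt.1 hb.2).1]
  have hm := hmixed b x y hb.1.1 hx.1.1 hy.1.1
  have hl := hL.norm_sub_le (x := a) (y := b) (hρu (by simpa [Real.dist_eq] using ha.1.2))
    (hρu (by simpa [Real.dist_eq] using hb.1.2))
  simp only [Real.norm_eq_abs] at hl
  rw [hab] at hl
  rw [show b + x - y = a by linarith] at hm
  have hl2 : (a ^ H - b ^ H) ^ 2 ≤ (L : ℝ) ^ 2 * (x - y) ^ 2 := by
    rw [← sq_abs, ← sq_abs (x - y), ← mul_pow]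
    exact pow_le_pow_left₀ (abs_nonneg _) hl 2
  have haa : a ^ (2 * H) = (a ^ H) ^ 2 := by
    rw [mul_comm, Real.rpow_mul ha0.le, Real.rpow_two]
  have hbb : b ^ (2 * H) = (b ^ H) ^ 2 := by
    rw [mul_comm, Real.rpow_mul hb0.le, Real.rpow_two]
  have hsplit : (b + x) ^ (2 * H) + (b - y) ^ (2 * H) - 2 * (a ^ H * b ^ H) =
      ((b + x) ^ (2 * H) - a ^ (2 * H) - (b ^ (2 * H) - (b - y) ^ (2 * H))) +
        (a ^ H - b ^ H) ^ 2 := by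
    rw [haa, hbb]; ring
  have h1 : C * |x| * |y| ≤ C * (x ^ 2 + y ^ 2) := by
    rw [mul_assoc]
    refine mul_le_mul_of_nonneg_left ?_ hC
    nlinarith [sq_abs x, sq_abs y, sq_nonneg (|x| - |y|), sq_nonneg (|x| + |y|)]
  have h2 : (L : ℝ) ^ 2 * (x - y) ^ 2 ≤ (L : ℝ) ^ 2 * (2 * (x ^ 2 + y ^ 2)) := by
    refine mul_le_mul_of_nonneg_left ?_ (sq_nonneg _)
    nlinarith [sq_nonneg (x + y)]
  rw [hsplit]
  refine (abs_add_le _ _).trans ?_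
  rw [abs_of_nonneg (sq_nonneg (a ^ H - b ^ H))]
  linarith

/-- With `a = t - s`, `b = t' - s'`, `x = t - t'`, `y = s - s'`, the analytic form of the expansion
of the correlation of two increments of a fractional Brownian motion. -/
theorem exists_fbm_correlation_expansion {H : ℝ} (hH0 : 0 < H) (hH1 : H < 1) {ε : ℝ} (hε : 0 < ε) :
    ∃ δ : ℝ, 0 < δ ∧ ∀ a b x y : ℝ, |a - 1| < δ → |b - 1| < δ → |x| + |y| < δ → a - b = x - y →
      |((b + x) ^ (2 * H) + (b - y) ^ (2 * H) - |x| ^ (2 * H) - |y| ^ (2 * H)) / 2 /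
          (a ^ H * b ^ H) - 1 + (1 / 2) * (|x| ^ (2 * H) + |y| ^ (2 * H))| ≤
        ε * ((1 / 2) * (|x| ^ (2 * H) + |y| ^ (2 * H))) := by
  obtain ⟨M, r, hM, hr, hquad⟩ := exists_abs_rpow_add_rpow_sub_le H
  have hP : ContinuousAt (fun z : ℝ × ℝ => (z.1 ^ H * z.2 ^ H)⁻¹) (1, 1) := by
    refine ContinuousAt.inv₀ (ContinuousAt.mul ?_ ?_) (by simp)
    · exact continuousAt_fst.rpow_const (Or.inl one_ne_zero)
    · exact continuousAt_snd.rpow_const (Or.inl one_ne_zero)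
  obtain ⟨r₁, hr₁, hP₁⟩ := Metric.continuousAt_iff.1 hP (min (ε / 2) 1) (by positivity)
  obtain ⟨η, hη, hMη⟩ : ∃ η : ℝ, 0 < η ∧ M * η ≤ ε / 4 := by
    refine ⟨ε / (4 * (M + 1)), by positivity, ?_⟩
    rw [mul_div_assoc', div_le_div_iff₀ (by positivity) (by norm_num)]
    nlinarith
  have hq : ContinuousAt (fun z : ℝ => |z| ^ (2 - 2 * H)) 0 :=
    continuous_abs.continuousAt.rpow_const (Or.inr (by linarith))
  obtain ⟨r₂, hr₂, hq₂⟩ := Metric.continuousAt_iff.1 hq η hη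
  have hsq : ∀ z : ℝ, |z| < r₂ → z ^ 2 ≤ η * |z| ^ (2 * H) := by
    intro z hz
    have h := hq₂ (x := z) (by simpa [Real.dist_eq] using hz)
    rw [abs_zero, Real.zero_rpow (by linarith), Real.dist_eq, sub_zero,
      abs_of_nonneg (by positivity)] at h
    have h2 : z ^ 2 = |z| ^ (2 - 2 * H) * |z| ^ (2 * H) := by
      rw [← Real.rpow_add_of_nonneg (abs_nonneg z) (by linarith) (by linarith), sub_add_cancel,
        Real.rpow_two, sq_abs]
    rw [h2]
    gcongr
  refine ⟨min (min r r₁) (min r₂ 1), by positivity, fun a b x y ha hb hxy hab => ?_⟩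
  simp only [lt_min_iff] at ha hb hxy
  have hx := abs_nonneg x
  have hy := abs_nonneg y
  have ha0 : 0 < a := by linarith [(abs_lt.1 ha.2.2).1]
  have hb0 : 0 < b := by linarith [(abs_lt.1 hb.2.2).1]
  have hX := hsq x (by linarith)
  have hY := hsq y (by linarith)
  have hN := hquad a b x y ha.1.1 hb.1.1 (by linarith) (by linarith) hab
  have hQ := hP₁ (x := (a, b)) (by
    rw [Prod.dist_eq]
    exact max_lt (by simpa [Real.dist_eq] using ha.1.2) (by simpa [Real.dist_eq] using hb.1.2))
  simp only [Real.one_rpow, mul_one, inv_one, Real.dist_eq, lt_min_iff] at hQ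
  have hP0 : 0 < a ^ H * b ^ H := by positivity
  have hX0 : 0 ≤ |x| ^ (2 * H) := by positivity
  have hY0 : 0 ≤ |y| ^ (2 * H) := by positivity
  generalize |x| ^ (2 * H) = X at *
  generalize |y| ^ (2 * H) = Y at *
  generalize (b + x) ^ (2 * H) + (b - y) ^ (2 * H) = S at *
  generalize a ^ H * b ^ H = P at *
  have hQ2 : P⁻¹ ≤ 2 := by linarith [(abs_lt.1 hQ.2).2]
  have hXY : 0 ≤ (X + Y) / 2 := by linarith
  have hNle : |S - 2 * P| ≤ ε / 4 * (X + Y) := by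
    calc |S - 2 * P| ≤ M * (x ^ 2 + y ^ 2) := hN
      _ ≤ M * (η * (X + Y)) := mul_le_mul_of_nonneg_left (by linarith) hM
      _ = M * η * (X + Y) := by ring
      _ ≤ ε / 4 * (X + Y) := mul_le_mul_of_nonneg_right hMη (by linarith)
  have hexp : (S - X - Y) / 2 / P - 1 + (1 / 2) * (X + Y) =
      (S - 2 * P) * P⁻¹ / 2 - (X + Y) / 2 * (P⁻¹ - 1) := by
    field_simp
    ring
  rw [hexp]
  calc |(S - 2 * P) * P⁻¹ / 2 - (X + Y) / 2 * (P⁻¹ - 1)|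
      ≤ |(S - 2 * P) * P⁻¹ / 2| + |(X + Y) / 2 * (P⁻¹ - 1)| := abs_sub _ _
    _ = |S - 2 * P| * P⁻¹ / 2 + (X + Y) / 2 * |P⁻¹ - 1| := by
      rw [abs_div, abs_mul, abs_mul, abs_of_pos (inv_pos.2 hP0), abs_of_nonneg hXY,
        abs_of_pos (two_pos : (0 : ℝ) < 2)]
    _ ≤ (ε / 4 * (X + Y)) * 2 / 2 + (X + Y) / 2 * (ε / 2) := by
      gcongr
      exact hQ.1.le
    _ = ε * ((1 / 2) * (X + Y)) := by ring

/-- Local expansion of the correlation of `Y_H(t,s) = B_H(t) - B_H(s)`: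
`r(t,s;t',s') = 1 - (1/2)(1+o(1))(|t-t'|^{2H} + |s-s'|^{2H})`
as `t-s → 1`, `t'-s' → 1`, `t-t' → 0`, `s-s' → 0`. -/
theorem shepp_fbm_correlation_expansion
    {Ω : Type*} [MeasurableSpace Ω] (μ : Measure Ω) [IsProbabilityMeasure μ]
    (H : ℝ) (hH : H ∈ Set.Ioo (0:ℝ) (1))
    (B : ℝ → Ω → ℝ)
    (hmeas : ∀ t : ℝ, Measurable (B t))
    (hzero : ∀ ω, B 0 ω = 0)
    (hcont : ∀ᵐ ω ∂μ, Continuous fun t => B t ω)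
    (hgauss : ∀ (n : ℕ) (c : Fin n → ℝ) (t : Fin n → ℝ),
      ∃ v : NNReal, μ.map (fun ω => ∑ i, c i * B (t i) ω) =
        ProbabilityTheory.gaussianReal 0 v)
    (hcov : ∀ t s : ℝ, 0 ≤ t → 0 ≤ s →
      ∫ ω, B t ω * B s ω ∂μ = (t ^ (2*H) + s ^ (2*H) - |t - s| ^ (2*H)) / 2)
    :
    ∀ ε : ℝ, 0 < ε → ∃ δ : ℝ, 0 < δ ∧ ∀ t s t' s' : ℝ,
      0 ≤ s → s < t → 0 ≤ s' → s' < t' →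
      |(t - s) - 1| < δ → |(t' - s') - 1| < δ →
      0 < |t - t'| + |s - s'| → |t - t'| + |s - s'| < δ →
      |(∫ ω, (B t ω - B s ω) * (B t' ω - B s' ω) ∂μ) /
          (Real.sqrt (∫ ω, (B t ω - B s ω)^2 ∂μ) *
            Real.sqrt (∫ ω, (B t' ω - B s' ω)^2 ∂μ)) -
        1 + (1/2) * (|t - t'| ^ (2*H) + |s - s'| ^ (2*H))| ≤
        ε * ((1/2) * (|t - t'| ^ (2*H) + |s - s'| ^ (2*H))) := by
  have hL2 : ∀ t : ℝ, MemLp (B t) 2 μ := by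
    intro t
    obtain ⟨v, hv⟩ := hgauss 1 (fun _ => 1) (fun _ => t)
    simp only [Finset.univ_unique, Finset.sum_singleton, one_mul] at hv
    have hid : MemLp id 2 (μ.map (B t)) := by
      change MemLp id 2 (μ.map fun ω => B t ω)
      rw [hv]
      exact memLp_id_gaussianReal 2
    exact (memLp_map_measure_iff aestronglyMeasurable_id (hmeas t).aemeasurable).1 hid
  have hint : ∀ t s : ℝ, Integrable (fun ω => B t ω * B s ω) μ :=
    fun t s => (hL2 t).integrable_mul (hL2 s)
  have hincr : ∀ t s t' s' : ℝ, 0 ≤ t → 0 ≤ s → 0 ≤ t' → 0 ≤ s' →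
      ∫ ω, (B t ω - B s ω) * (B t' ω - B s' ω) ∂μ =
        (|t - s'| ^ (2 * H) + |s - t'| ^ (2 * H) - |t - t'| ^ (2 * H) - |s - s'| ^ (2 * H)) / 2 := by
    intro t s t' s' ht hs ht' hs'
    have hexp : ∀ ω, (B t ω - B s ω) * (B t' ω - B s' ω) =
        (B t ω * B t' ω - B t ω * B s' ω) - (B s ω * B t' ω - B s ω * B s' ω) := fun ω => by ring
    simp only [hexp]
    rw [integral_sub (f := fun ω => B t ω * B t' ω - B t ω * B s' ω)
        (g := fun ω => B s ω * B t' ω - B s ω * B s' ω)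
        ((hint _ _).sub (hint _ _)) ((hint _ _).sub (hint _ _)),
      integral_sub (hint _ _) (hint _ _), integral_sub (hint _ _) (hint _ _),
      hcov _ _ ht ht', hcov _ _ ht hs', hcov _ _ hs ht', hcov _ _ hs hs']
    ring
  have hsqrt : ∀ t s : ℝ, 0 ≤ s → s < t →
      Real.sqrt (∫ ω, (B t ω - B s ω) ^ 2 ∂μ) = (t - s) ^ H := by
    intro t s hs hst
    have h2H : 2 * H ≠ 0 := by linarith [hH.1]
    have hts : 0 < t - s := sub_pos.2 hst
    simp only [pow_two]
    rw [hincr t s t s (hs.trans hst.le) hs (hs.trans hst.le) hs, abs_sub_comm s t, abs_of_pos hts,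
      sub_self, sub_self, abs_zero, Real.zero_rpow h2H, sub_zero, sub_zero, add_self_div_two,
      mul_comm 2 H, Real.rpow_mul hts.le, Real.rpow_two, Real.sqrt_sq (by positivity)]
  intro ε hε
  obtain ⟨δ, hδ, h⟩ := exists_fbm_correlation_expansion hH.1 hH.2 hε
  refine ⟨min δ (1 / 2), by positivity, fun t s t' s' hs hst hs' hst' ha hb _ hxy => ?_⟩
  rw [lt_min_iff] at ha hb hxy
  have hx := neg_abs_le (t - t')
  have hy := le_abs_self (s - s')
  have hb2 := abs_lt.1 hb.2
  have hx0 := abs_nonneg (t - t')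
  have hy0 := abs_nonneg (s - s')
  have key := h (t - s) (t' - s') (t - t') (s - s') ha.1 hb.1 hxy.1 (by ring)
  rw [show t' - s' + (t - t') = t - s' by ring, show t' - s' - (s - s') = t' - s by ring] at key
  rwa [hincr t s t' s' (hs.trans hst.le) hs (hs'.trans hst'.le) hs', hsqrt t s hs hst,
    hsqrt t' s' hs' hst', abs_sub_comm s t', abs_of_pos (a := t - s') (by linarith),
    abs_of_pos (a := t' - s) (by linarith)]
end

section
/- Let H ∈ (0, 1/2), H' ∈ (2H, 1), T > 0, and set R_u = u^{−2/H'} and δ_u = (ln u)²/u². Let Y_H(t, s) = B_H(t) − B_H(s). There exist constants C > 0 and c* > 0 such that for all sufficiently large u, for any two axis-parallel squares A and B of side length R_u contained in the region {(t, s) : 0 ≤ s ≤ T, 1 − δ_u ≤ t − s ≤ 1} whose Euclidean distance is at least R_u, one has P( max_{(t,s) ∈ A} Y_H(t, s) > u, max_{(t',s') ∈ B} Y_H(t', s') > u ) ≤ C · R_u² · u^{4/H} · exp( −c* u² R_u^{2H} ) · Ψ(u). In particular, for every real a, this probability is o( u^{a} Ψ(u) ) as u → ∞, uniformly in such pairs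 of squares. -/
open MeasureTheory ProbabilityTheory Real Filter Set

/-- Supremum of `Y_H(t,s) = B_H(t) - B_H(s)` over the axis-parallel square
`[a₁, a₁+R] × [a₂, a₂+R]`. -/
noncomputable def supYOnSquare {Ω : Type*} (B : ℝ → Ω → ℝ) (a₁ a₂ R : ℝ) (ω : Ω) : ℝ :=
  ⨆ (t : Set.Icc a₁ (a₁ + R)) (s : Set.Icc a₂ (a₂ + R)), (B (t:ℝ) ω - B (s:ℝ) ω)

/-- The region `{(t,s) : 0 ≤ s ≤ T, 1 - δ_u ≤ t - s ≤ 1}`. -/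
def sheppRegion (T du : ℝ) : Set (ℝ × ℝ) :=
  {p : ℝ × ℝ | 0 ≤ p.2 ∧ p.2 ≤ T ∧ 1 - du ≤ p.1 - p.2 ∧ p.1 - p.2 ≤ 1}

/-- A process `B` on `(Ω, μ)` whose restriction to `[0, ∞)` is a fractional Brownian motion with
Hurst index `H`. -/
structure IsFractionalBrownianMotion {Ω : Type*} [MeasurableSpace Ω] (μ : Measure Ω) (H : ℝ)
    (B : ℝ → Ω → ℝ) : Prop where
  measurable : ∀ t : ℝ, Measurable (B t)
  ae_continuous : ∀ᵐ ω ∂μ, Continuous fun t => B t ω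
  gaussian : ∀ (n : ℕ) (c : Fin n → ℝ) (t : Fin n → ℝ),
    ∃ v : NNReal, μ.map (fun ω => ∑ i, c i * B (t i) ω) = gaussianReal 0 v
  covariance : ∀ t s : ℝ, 0 ≤ t → 0 ≤ s →
    ∫ ω, B t ω * B s ω ∂μ = (t ^ (2 * H) + s ^ (2 * H) - |t - s| ^ (2 * H)) / 2

/-- Gaussian tail bound for a centered normal variable of variance at most `V`. -/
theorem measureReal_ge_le_exp_of_map_eq_gaussianReal {Ω : Type*} [MeasurableSpace Ω]
    {μ : Measure Ω} [IsProbabilityMeasure μ] {X : Ω → ℝ} {v : NNReal}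
    (hX : μ.map X = gaussianReal 0 v) {V x : ℝ} (hV : v ≤ V) (hx : 0 ≤ x) :
    μ.real {ω | x ≤ X ω} ≤ exp (-x ^ 2 / (2 * V)) := by
  have hXm : AEMeasurable X μ := aemeasurable_of_map_neZero (by rw [hX]; infer_instance)
  lift V to NNReal using v.2.trans hV
  have h : HasSubgaussianMGF X V μ :=
    { integrable_exp_mul := fun t => by
        have h := integrable_exp_mul_gaussianReal (μ := 0) (v := v) t
        rw [← hX] at h
        exact h.comp_aemeasurable hXm
      mgf_le := fun t => by
        rw [mgf_gaussianReal hX, zero_mul, zero_add]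
        gcongr }
  exact h.measure_ge_le hx

theorem integral_sq_of_map_eq_gaussianReal {Ω : Type*} [MeasurableSpace Ω]
    {μ : Measure Ω} {X : Ω → ℝ} {v : NNReal}
    (hX : μ.map X = gaussianReal 0 v) : ∫ ω, X ω ^ 2 ∂μ = v := by
  have hXm : AEMeasurable X μ := aemeasurable_of_map_neZero (by rw [hX]; infer_instance)
  have h := variance_fun_id_gaussianReal (μ := 0) (v := v)
  rw [variance_of_integral_eq_zero (by fun_prop) (by simp), ← hX,
    integral_map hXm (by fun_prop)] at h
  exact h

/-- The covariance function of fractional Brownian motion with Hurst index `H`. -/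
noncomputable def fbmCov (H t s : ℝ) : ℝ :=
  (t ^ (2 * H) + s ^ (2 * H) - |t - s| ^ (2 * H)) / 2

namespace IsFractionalBrownianMotion

variable {Ω : Type*} [MeasurableSpace Ω] {μ : Measure Ω} {H : ℝ}
  {B : ℝ → Ω → ℝ}

theorem memLp_two (hB : IsFractionalBrownianMotion μ H B) (t : ℝ) : MemLp (B t) 2 μ := by
  obtain ⟨v, hv⟩ := hB.gaussian 1 (fun _ => 1) (fun _ => t)
  simp only [one_mul, Finset.univ_unique, Finset.sum_const, Finset.card_singleton, one_smul] at hv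
  have h := memLp_id_gaussianReal' (μ := 0) (v := v) 2 (by simp)
  rw [← hv] at h
  exact h.comp_of_map (hB.measurable t).aemeasurable

theorem measureReal_sum_ge_le [IsProbabilityMeasure μ] (hB : IsFractionalBrownianMotion μ H B) {n : ℕ} (c t : Fin n → ℝ)
    (ht : ∀ i, 0 ≤ t i) {V x : ℝ} (hx : 0 ≤ x)
    (hV : ∑ i, ∑ j, c i * c j * fbmCov H (t i) (t j) ≤ V) :
    μ.real {ω | x ≤ ∑ i, c i * B (t i) ω} ≤ exp (-x ^ 2 / (2 * V)) := by
  obtain ⟨v, hv⟩ := hB.gaussian n c t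
  refine measureReal_ge_le_exp_of_map_eq_gaussianReal hv (hV.trans' (le_of_eq ?_)) hx
  have hint (i j : Fin n) : Integrable (fun ω => c i * c j * (B (t i) ω * B (t j) ω)) μ :=
    ((hB.memLp_two (t i)).integrable_mul (hB.memLp_two (t j))).const_mul _
  rw [← integral_sq_of_map_eq_gaussianReal hv]
  calc ∫ ω, (∑ i, c i * B (t i) ω) ^ 2 ∂μ
      = ∫ ω, ∑ i, ∑ j, c i * c j * (B (t i) ω * B (t j) ω) ∂μ := by
        congr with ω
        rw [sq, Finset.sum_mul_sum]
        exact Finset.sum_congr rfl fun i _ => Finset.sum_congr rfl fun j _ => by ring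
    _ = ∑ i, ∑ j, c i * c j * fbmCov H (t i) (t j) := by
        rw [integral_finsetSum _ fun i _ => integrable_finsetSum _ fun j _ => hint i j]
        refine Finset.sum_congr rfl fun i _ => ?_
        rw [integral_finsetSum _ fun j _ => hint i j]
        refine Finset.sum_congr rfl fun j _ => ?_
        rw [integral_const_mul, hB.covariance _ _ (ht i) (ht j), fbmCov]

theorem measureReal_abs_sub_ge_le [IsProbabilityMeasure μ] (hB : IsFractionalBrownianMotion μ H B) (hH : 0 < H) {t s x : ℝ}
    (ht : 0 ≤ t) (hs : 0 ≤ s) (hx : 0 ≤ x) :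
    μ.real {ω | x ≤ |B t ω - B s ω|} ≤ 2 * exp (-x ^ 2 / (2 * |t - s| ^ (2 * H))) := by
  have key (a b : ℝ) (ha : 0 ≤ a) (hb : 0 ≤ b) :
      μ.real {ω | x ≤ B a ω - B b ω} ≤ exp (-x ^ 2 / (2 * |a - b| ^ (2 * H))) := by
    have h := hB.measureReal_sum_ge_le ![1, -1] ![a, b]
      (by simp [Fin.forall_fin_two, ha, hb]) (V := |a - b| ^ (2 * H)) hx (by
        have : (0 : ℝ) ^ (2 * H) = 0 := zero_rpow (by positivity)
        simp [Fin.sum_univ_two, fbmCov, abs_sub_comm b a, this]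
        linarith)
    simpa [Fin.sum_univ_two, ← sub_eq_add_neg] using h
  calc μ.real {ω | x ≤ |B t ω - B s ω|}
      ≤ μ.real ({ω | x ≤ B t ω - B s ω} ∪ {ω | x ≤ B s ω - B t ω}) := by
        refine measureReal_mono fun ω hω => ?_
        simpa [le_abs] using hω
    _ ≤ _ := measureReal_union_le _ _
    _ ≤ _ := by
        have h1 := key t s ht hs
        have h2 := key s t hs ht
        rw [abs_sub_comm s t] at h2
        linarith

end IsFractionalBrownianMotion

/-- Variance of `Y(t, s) + Y(t', s')`, where `Y(t, s) = B(t) - B(s)`. -/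
noncomputable def varAdd (H t s t' s' : ℝ) : ℝ :=
  |t - s| ^ (2 * H) + |t' - s'| ^ (2 * H) + |t - s'| ^ (2 * H) + |s - t'| ^ (2 * H)
    - |t - t'| ^ (2 * H) - |s - s'| ^ (2 * H)

theorem IsFractionalBrownianMotion.measureReal_add_ge_le {Ω : Type*} [MeasurableSpace Ω]
    {μ : Measure Ω} [IsProbabilityMeasure μ] {H : ℝ} {B : ℝ → Ω → ℝ}
    (hB : IsFractionalBrownianMotion μ H B) (hH : 0 < H) {t s t' s' : ℝ}
    (ht : 0 ≤ t) (hs : 0 ≤ s) (ht' : 0 ≤ t') (hs' : 0 ≤ s') {V x : ℝ} (hx : 0 ≤ x)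
    (hV : varAdd H t s t' s' ≤ V) :
    μ.real {ω | x ≤ (B t ω - B s ω) + (B t' ω - B s' ω)} ≤ exp (-x ^ 2 / (2 * V)) := by
  have h := hB.measureReal_sum_ge_le ![1, -1, 1, -1] ![t, s, t', s']
    (by simp [Fin.forall_fin_succ, *]) (V := V) hx (by
      refine le_trans (le_of_eq ?_) hV
      have : (0 : ℝ) ^ (2 * H) = 0 := zero_rpow (by positivity)
      simp [Fin.sum_univ_four, fbmCov, varAdd, this, abs_sub_comm s t, abs_sub_comm t' t,
        abs_sub_comm t' s, abs_sub_comm s' t, abs_sub_comm s' s, abs_sub_comm s' t']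
      ring)
  refine le_trans (le_of_eq ?_) h
  congr 1
  ext ω
  simp only [Fin.sum_univ_four, mem_ofPred_eq]
  simp
  constructor <;> intro h <;> linarith

/-- Lower bound for the variance of `Y(t, s) - Y(t', s')` when `s' ≤ s`. -/
theorem rpow_le_var_sub_of_le {α t s t' s' r : ℝ} (h0 : 0 ≤ α) (h1 : α ≤ 1) (hr : 0 ≤ r)
    (hv : r ≤ t - s) (hv' : r ≤ t' - s') (hss : s' ≤ s) (h : r ≤ |t - t'| ∨ r ≤ |s - s'|) :
    r ^ α ≤ |t - s| ^ α + |t' - s'| ^ α - |t - s'| ^ α - |s - t'| ^ α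
      + |t - t'| ^ α + |s - s'| ^ α := by
  have mono {a b : ℝ} (ha : 0 ≤ a) (hab : a ≤ b) : a ^ α ≤ b ^ α := rpow_le_rpow ha hab h0
  have sub {a b : ℝ} (ha : 0 ≤ a) (hb : 0 ≤ b) : (a + b) ^ α ≤ a ^ α + b ^ α :=
    Real.rpow_add_le_add_rpow ha hb h0 h1
  have e1 : |t - s| = t - s := abs_of_nonneg (by linarith)
  have e2 : |t' - s'| = t' - s' := abs_of_nonneg (by linarith)
  have e3 : |t - s'| = t - s' := abs_of_nonneg (by linarith)
  have e4 : |s - s'| = s - s' := abs_of_nonneg (by linarith)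
  rw [e4] at h ⊢
  rw [e1, e2, e3]
  rcases h with h | h
  · have a1 : (t - s') ^ α ≤ (t - s) ^ α + (s - s') ^ α := by
      have := sub (a := t - s) (b := s - s') (by linarith) (by linarith)
      rwa [sub_add_sub_cancel] at this
    rcases le_or_gt |s - t'| (t' - s') with h2 | h2
    · have a2 := mono (abs_nonneg (s - t')) h2
      have a3 := mono hr h
      linarith
    · have h3 : |s - t'| ≤ |t - t'| := by
        rcases lt_abs.1 h2 with h4 | h4
        · rw [abs_of_nonneg (by linarith), le_abs]; left; linarith
        · linarith
      have a2 := mono (abs_nonneg (s - t')) h3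
      have a3 := mono hr hv'
      linarith
  · rcases le_or_gt t' t with ht | ht
    · have e5 : |t - t'| = t - t' := abs_of_nonneg (by linarith)
      rw [e5]
      have a1 : (t - s') ^ α ≤ (t - t') ^ α + (t' - s') ^ α := by
        have := sub (a := t - t') (b := t' - s') (by linarith) (by linarith)
        rwa [sub_add_sub_cancel] at this
      rcases le_or_gt |s - t'| (t - s) with h2 | h2
      · have a2 := mono (abs_nonneg (s - t')) h2
        have a3 := mono hr h
        linarith
      · have h3 : |s - t'| ≤ s - s' := by
          rcases lt_abs.1 h2 with h4 | h4
          · rw [abs_of_nonneg (by linarith)]; linarith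
          · linarith
        have a2 := mono (abs_nonneg (s - t')) h3
        have a3 := mono hr hv
        linarith
    · have e5 : |t - t'| = t' - t := by rw [abs_of_neg (by linarith)]; ring
      have e6 : |s - t'| = t' - s := by rw [abs_of_neg (by linarith)]; ring
      rw [e5, e6]
      have a1 : (t' - s) ^ α ≤ (t' - t) ^ α + (t - s) ^ α := by
        have := sub (a := t' - t) (b := t - s) (by linarith) (by linarith)
        rwa [sub_add_sub_cancel] at this
      have a2 := mono (a := t - s') (b := t' - s') (by linarith) (by linarith)
      have a3 := mono hr h
      linarith

/-- Lower bound for the variance of `Y(t, s) - Y(t', s')`. -/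
theorem rpow_le_var_sub {α t s t' s' r : ℝ} (h0 : 0 ≤ α) (h1 : α ≤ 1) (hr : 0 ≤ r)
    (hv : r ≤ t - s) (hv' : r ≤ t' - s') (h : r ≤ |t - t'| ∨ r ≤ |s - s'|) :
    r ^ α ≤ |t - s| ^ α + |t' - s'| ^ α - |t - s'| ^ α - |s - t'| ^ α
      + |t - t'| ^ α + |s - s'| ^ α := by
  rcases le_total s' s with hss | hss
  · exact rpow_le_var_sub_of_le h0 h1 hr hv hv' hss h
  · have := rpow_le_var_sub_of_le h0 h1 hr hv' hv hss (by rwa [abs_sub_comm t', abs_sub_comm s'])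
    rw [abs_sub_comm t' s, abs_sub_comm s' t, abs_sub_comm t' t, abs_sub_comm s' s] at this
    linarith

/-- Upper bound for the variance of `Y(t, s) + Y(t', s')` at distant points of a strip
`1 / 2 ≤ t - s ≤ 1 + h`. -/
theorem varAdd_le {H t s t' s' r h : ℝ} (hH : H ∈ Set.Ioo (0 : ℝ) (1 / 2)) (hr : 0 ≤ r)
    (hr' : r ≤ 1 / 2) (hv : t - s ∈ Set.Icc (1 / 2) (1 + h)) (hv' : t' - s' ∈ Set.Icc (1 / 2) (1 + h))
    (hh : 0 ≤ h) (hd : r ≤ |t - t'| ∨ r ≤ |s - s'|) :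
    varAdd H t s t' s' ≤ 4 + 4 * h - r ^ (2 * H) := by
  have key {v : ℝ} (hv : v ∈ Set.Icc (1 / 2) (1 + h)) : |v| ^ (2 * H) ≤ 1 + h := by
    rw [abs_of_nonneg (by linarith [hv.1])]
    calc v ^ (2 * H) ≤ (1 + h) ^ (2 * H) :=
          rpow_le_rpow (by linarith [hv.1]) hv.2 (by linarith [hH.1])
      _ ≤ (1 + h) ^ (1 : ℝ) := rpow_le_rpow_of_exponent_le (by linarith) (by linarith [hH.2])
      _ = 1 + h := rpow_one _
  have h1 := rpow_le_var_sub (α := 2 * H) (by linarith [hH.1]) (by linarith [hH.2]) hr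
    (hr'.trans hv.1) (hr'.trans hv'.1) hd
  have h2 := key hv
  have h3 := key hv'
  unfold varAdd
  linarith

/-- The left endpoint of the dyadic interval of length `2 ^ (-n)` containing `t`. -/
noncomputable def dyadicFloor (n : ℕ) (t : ℝ) : ℝ := ⌊t * 2 ^ n⌋₊ / 2 ^ n

theorem dyadicFloor_nonneg (n : ℕ) (t : ℝ) : 0 ≤ dyadicFloor n t := by
  unfold dyadicFloor; positivity

theorem dyadicFloor_le (n : ℕ) {t : ℝ} (ht : 0 ≤ t) : dyadicFloor n t ≤ t := by
  rw [dyadicFloor, div_le_iff₀ (by positivity)]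
  exact Nat.floor_le (by positivity)

theorem sub_lt_dyadicFloor (n : ℕ) (t : ℝ) : t - (2 ^ n)⁻¹ < dyadicFloor n t := by
  have h2 : (0 : ℝ) < 2 ^ n := by positivity
  rw [dyadicFloor, lt_div_iff₀ h2, sub_mul, inv_mul_cancel₀ h2.ne', sub_lt_iff_lt_add]
  exact Nat.lt_floor_add_one _

theorem tendsto_dyadicFloor {t : ℝ} (ht : 0 ≤ t) :
    Tendsto (fun n => dyadicFloor n t) atTop (nhds t) := by
  have h : Tendsto (fun n : ℕ => t - ((2 : ℝ) ^ n)⁻¹) atTop (nhds (t - 0)) := by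
    refine tendsto_const_nhds.sub ?_
    simp_rw [← inv_pow]
    exact tendsto_pow_atTop_nhds_zero_of_lt_one (by norm_num) (by norm_num)
  rw [sub_zero] at h
  exact tendsto_of_tendsto_of_tendsto_of_le_of_le h tendsto_const_nhds
    (fun n => (sub_lt_dyadicFloor n t).le) (fun n => dyadicFloor_le n ht)

/-- Consecutive dyadic approximations agree or are consecutive at the finer level. -/
theorem dyadicFloor_succ (n : ℕ) {t L : ℝ} (ht : 0 ≤ t) (htL : t ≤ L) :
    dyadicFloor (n + 1) t = dyadicFloor n t ∨
      ∃ j < ⌊L * 2 ^ (n + 1)⌋₊ + 1, dyadicFloor n t = j / 2 ^ (n + 1) ∧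
        dyadicFloor (n + 1) t = (j + 1) / 2 ^ (n + 1) := by
  have e : dyadicFloor n t = (2 * ⌊t * 2 ^ n⌋₊ : ℕ) / 2 ^ (n + 1) := by
    rw [dyadicFloor]; push_cast; rw [pow_succ]; field_simp
  have l1 : 2 * ⌊t * 2 ^ n⌋₊ ≤ ⌊t * 2 ^ (n + 1)⌋₊ := by
    apply Nat.le_floor
    push_cast
    have := Nat.floor_le (show 0 ≤ t * 2 ^ n by positivity)
    rw [pow_succ]; linarith
  have l2 : ⌊t * 2 ^ (n + 1)⌋₊ < 2 * ⌊t * 2 ^ n⌋₊ + 2 := by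
    rw [Nat.floor_lt (by positivity)]
    push_cast
    have := Nat.lt_floor_add_one (t * 2 ^ n)
    rw [pow_succ]; linarith
  have l3 : ⌊t * 2 ^ (n + 1)⌋₊ ≤ ⌊L * 2 ^ (n + 1)⌋₊ := by gcongr
  rcases (show ⌊t * 2 ^ (n + 1)⌋₊ = 2 * ⌊t * 2 ^ n⌋₊ ∨
      ⌊t * 2 ^ (n + 1)⌋₊ = 2 * ⌊t * 2 ^ n⌋₊ + 1 by omega) with h | h
  · left; rw [e, dyadicFloor, h]
  · right
    refine ⟨2 * ⌊t * 2 ^ n⌋₊, by omega, e, ?_⟩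
    rw [dyadicFloor, h]; push_cast; rfl

/-- Chaining: control of dyadic increments gives uniform control of the dyadic approximation. -/
theorem abs_sub_dyadicFloor_le {f : ℝ → ℝ} (hf : Continuous f) {q L : ℝ} (hq0 : 0 ≤ q) (hq1 : q < 1)
    {N : ℕ} (h : ∀ n, N ≤ n → ∀ j < ⌊L * 2 ^ (n + 1)⌋₊ + 1,
      |f ((j + 1) / 2 ^ (n + 1)) - f (j / 2 ^ (n + 1))| ≤ q ^ (n + 1)) {t : ℝ} (ht : 0 ≤ t)
    (htL : t ≤ L) : |f t - f (dyadicFloor N t)| ≤ q ^ N / (1 - q) := by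
  have hlim : Tendsto (fun n => f (dyadicFloor (N + n) t)) atTop (nhds (f t)) := by
    refine (hf.tendsto t).comp ?_
    exact (tendsto_dyadicFloor ht).comp (tendsto_atTop_mono (fun n => Nat.le_add_left n N) tendsto_id)
  have := dist_le_of_le_geometric_of_tendsto₀ q (q ^ N) hq1 (fun n => ?_) hlim
  · rwa [add_zero, dist_comm, Real.dist_eq] at this
  · rw [dist_comm, Real.dist_eq, ← pow_add, ← add_assoc]
    rcases dyadicFloor_succ (N + n) ht htL with h1 | ⟨j, hj, h1, h2⟩
    · rw [h1, sub_self, abs_zero]; positivity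
    · rw [h1, h2]
      refine (h _ (Nat.le_add_right N n) j hj).trans ?_
      exact pow_le_pow_of_le_one hq0 hq1.le (Nat.le_succ _)

theorem summable_two_pow_mul_exp_neg {H : ℝ} (hH : 0 < H) :
    Summable fun n : ℕ => (2 : ℝ) ^ n * exp (-((2 : ℝ) ^ n) ^ H / 4) := by
  have h1 : Tendsto (fun n : ℕ => ((2 : ℝ) ^ n) ^ H) atTop atTop :=
    (tendsto_rpow_atTop hH).comp (tendsto_pow_atTop_atTop_of_one_lt (by norm_num))
  have h2 := (tendsto_rpow_mul_exp_neg_mul_atTop_nhds_zero (2 / H) (1 / 4) (by norm_num)).comp h1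
  refine Summable.of_norm_bounded_eventually_nat
    (summable_geometric_of_lt_one (r := (1 / 2 : ℝ)) (by norm_num) (by norm_num)) ?_
  filter_upwards [h2.eventually_le_const one_pos] with n hn
  have e : (((2 : ℝ) ^ n) ^ H) ^ (2 / H) = 2 ^ n * 2 ^ n := by
    rw [← rpow_mul (by positivity), mul_div_cancel₀ _ hH.ne', rpow_two, sq]
  rw [Function.comp_apply, e] at hn
  rw [norm_of_nonneg (by positivity), one_div, inv_pow, le_inv_comm₀ (by positivity) (by positivity),
    ← one_div, le_div_iff₀ (by positivity)]
  convert hn using 1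
  ring_nf

/-- The event that some dyadic increment of `B` on `[0, L]`, at a level finer than `N`, exceeds its
geometric threshold. -/
def largeDyadicIncrement {Ω : Type*} (B : ℝ → Ω → ℝ) (q L : ℝ) (N : ℕ) : Set Ω :=
  {ω | ∃ n, N ≤ n ∧ ∃ j < ⌊L * 2 ^ (n + 1)⌋₊ + 1,
    q ^ (n + 1) ≤ |B ((j + 1) / 2 ^ (n + 1)) ω - B (j / 2 ^ (n + 1)) ω|}

namespace IsFractionalBrownianMotion

variable {Ω : Type*} [MeasurableSpace Ω] {μ : Measure Ω} [IsProbabilityMeasure μ] {H : ℝ}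
  {B : ℝ → Ω → ℝ}

theorem measureReal_dyadic_increment_le (hB : IsFractionalBrownianMotion μ H B) (hH : 0 < H)
    (n j : ℕ) :
    μ.real {ω | ((2 : ℝ) ^ (-H / 2)) ^ n ≤ |B ((j + 1) / 2 ^ n) ω - B (j / 2 ^ n) ω|} ≤
      2 * exp (-((2 : ℝ) ^ n) ^ H / 2) := by
  refine (hB.measureReal_abs_sub_ge_le hH (by positivity) (by positivity)
    (by positivity)).trans_eq ?_
  have e1 : |((j : ℝ) + 1) / 2 ^ n - j / 2 ^ n| = ((2 : ℝ) ^ n)⁻¹ := by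
    rw [← sub_div, add_sub_cancel_left, one_div, abs_of_nonneg (by positivity)]
  have e2 : (((2 : ℝ) ^ (-H / 2)) ^ n) ^ 2 = (((2 : ℝ) ^ n) ^ H)⁻¹ := by
    rw [← rpow_natCast _ n, ← rpow_natCast _ 2, ← rpow_natCast _ n, ← rpow_mul (by positivity),
      ← rpow_mul (by positivity), ← rpow_mul (by positivity), ← rpow_neg (by positivity)]
    congr 1
    push_cast
    ring
  have e3 : (((2 : ℝ) ^ n)⁻¹) ^ (2 * H) = ((((2 : ℝ) ^ n) ^ H) ^ 2)⁻¹ := by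
    rw [inv_rpow (by positivity), mul_comm, rpow_mul (by positivity), rpow_two]
  rw [e1, e2, e3]
  have : 0 < ((2 : ℝ) ^ n) ^ H := by positivity
  congr 2
  field_simp

theorem exists_measureReal_largeDyadicIncrement_le (hB : IsFractionalBrownianMotion μ H B)
    (hH : 0 < H) {L : ℝ} (hL : 0 ≤ L) :
    ∃ K, 0 ≤ K ∧ ∀ N, μ.real (largeDyadicIncrement B (2 ^ (-H / 2)) L N) ≤
      K * exp (-((2 : ℝ) ^ N) ^ H / 4) := by
  set a : ℕ → ℝ := fun n =>
    2 * (L + 1) * (2 ^ (n + 1) * exp (-((2 : ℝ) ^ (n + 1)) ^ H / 4)) with ha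
  have hsum : Summable a :=
    ((summable_nat_add_iff 1).2 (summable_two_pow_mul_exp_neg hH)).mul_left _
  have ha0 : ∀ n, 0 ≤ a n := fun n => by positivity
  refine ⟨∑' n, a n, tsum_nonneg ha0, fun N => ?_⟩
  set E := exp (-((2 : ℝ) ^ N) ^ H / 4)
  have hlevel (n : ℕ) : μ {ω | N ≤ n ∧ ∃ j < ⌊L * 2 ^ (n + 1)⌋₊ + 1, ((2 : ℝ) ^ (-H / 2)) ^ (n + 1)
      ≤ |B ((j + 1) / 2 ^ (n + 1)) ω - B (j / 2 ^ (n + 1)) ω|} ≤ ENNReal.ofReal (a n * E) := by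
    by_cases hn : N ≤ n
    · rw [← ofReal_measureReal]
      refine ENNReal.ofReal_le_ofReal ?_
      have hEn : exp (-((2 : ℝ) ^ (n + 1)) ^ H / 4) ≤ E := by
        have : ((2 : ℝ) ^ N) ^ H ≤ ((2 : ℝ) ^ (n + 1)) ^ H :=
          rpow_le_rpow (by positivity) (pow_le_pow_right₀ (by norm_num) (by omega)) hH.le
        exact exp_le_exp.2 (by linarith)
      have hcard : ((⌊L * 2 ^ (n + 1)⌋₊ + 1 : ℕ) : ℝ) ≤ (L + 1) * 2 ^ (n + 1) := by
        have h1 := Nat.floor_le (show 0 ≤ L * 2 ^ (n + 1) by positivity)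
        have h2 : (1 : ℝ) ≤ 2 ^ (n + 1) := one_le_pow₀ (by norm_num)
        push_cast
        linarith
      calc _ ≤ μ.real (⋃ j ∈ Finset.range (⌊L * 2 ^ (n + 1)⌋₊ + 1), {ω |
              ((2 : ℝ) ^ (-H / 2)) ^ (n + 1) ≤
                |B ((j + 1) / 2 ^ (n + 1)) ω - B (j / 2 ^ (n + 1)) ω|}) := by
            refine measureReal_mono (fun ω hω => ?_) (measure_ne_top _ _)
            obtain ⟨_, j, hj, h⟩ := hω
            simp only [mem_iUnion]
            exact ⟨j, Finset.mem_range.2 hj, h⟩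
        _ ≤ ∑ j ∈ Finset.range (⌊L * 2 ^ (n + 1)⌋₊ + 1),
              2 * exp (-((2 : ℝ) ^ (n + 1)) ^ H / 2) :=
            (measureReal_biUnion_finset_le _ _).trans
              (Finset.sum_le_sum fun j _ => hB.measureReal_dyadic_increment_le hH (n + 1) j)
        _ = (⌊L * 2 ^ (n + 1)⌋₊ + 1 : ℕ) * (2 * (exp (-((2 : ℝ) ^ (n + 1)) ^ H / 4) *
              exp (-((2 : ℝ) ^ (n + 1)) ^ H / 4))) := by
            rw [Finset.sum_const, Finset.card_range, nsmul_eq_mul, ← exp_add]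
            ring_nf
        _ ≤ ((L + 1) * 2 ^ (n + 1)) * (2 * (exp (-((2 : ℝ) ^ (n + 1)) ^ H / 4) * E)) := by
            gcongr
        _ = a n * E := by rw [ha]; ring
    · simp [hn]
  refine ENNReal.toReal_le_of_le_ofReal (mul_nonneg (tsum_nonneg ha0) (exp_pos _).le) ?_
  calc μ (largeDyadicIncrement B (2 ^ (-H / 2)) L N)
      = μ (⋃ n, {ω | N ≤ n ∧ ∃ j < ⌊L * 2 ^ (n + 1)⌋₊ + 1, ((2 : ℝ) ^ (-H / 2)) ^ (n + 1)
          ≤ |B ((j + 1) / 2 ^ (n + 1)) ω - B (j / 2 ^ (n + 1)) ω|}) := by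
        congr 1
        ext ω
        simp [largeDyadicIncrement]
    _ ≤ ∑' n, ENNReal.ofReal (a n * E) := (measure_iUnion_le _).trans (ENNReal.tsum_le_tsum hlevel)
    _ = ENNReal.ofReal ((∑' n, a n) * E) := by
        rw [← ENNReal.ofReal_tsum_of_nonneg (fun n => mul_nonneg (ha0 n) (exp_pos _).le)
          (hsum.mul_right _), tsum_mul_right]

end IsFractionalBrownianMotion

theorem exists_lt_of_lt_supYOnSquare {Ω : Type*} {B : ℝ → Ω → ℝ} {a₁ a₂ R u : ℝ} {ω : Ω}
    (hu : 0 ≤ u) (h : u < supYOnSquare B a₁ a₂ R ω) :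
    ∃ t ∈ Set.Icc a₁ (a₁ + R), ∃ s ∈ Set.Icc a₂ (a₂ + R), u < B t ω - B s ω := by
  by_contra! hc
  exact h.not_ge (Real.iSup_le (fun t => Real.iSup_le (fun s => hc t t.2 s s.2) hu) hu)

/-- Union bound over a dyadic grid for the joint exceedance probability. -/
theorem IsFractionalBrownianMotion.measureReal_joint_exceedance_le {Ω : Type*} [MeasurableSpace Ω]
    {μ : Measure Ω} [IsProbabilityMeasure μ] {H : ℝ} {B : ℝ → Ω → ℝ}
    (hB : IsFractionalBrownianMotion μ H B) (hH : H ∈ Set.Ioo (0 : ℝ) (1 / 2))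
    {a₁ a₂ b₁ b₂ R T δ u x q : ℝ} {N : ℕ} (hδ : δ ≤ 1 / 4)
    (hA : Set.Icc a₁ (a₁ + R) ×ˢ Set.Icc a₂ (a₂ + R) ⊆ sheppRegion T δ)
    (hA' : Set.Icc b₁ (b₁ + R) ×ˢ Set.Icc b₂ (b₂ + R) ⊆ sheppRegion T δ)
    (hdist : ∀ p ∈ Set.Icc a₁ (a₁ + R) ×ˢ Set.Icc a₂ (a₂ + R),
      ∀ p' ∈ Set.Icc b₁ (b₁ + R) ×ˢ Set.Icc b₂ (b₂ + R),
        R ≤ Real.sqrt ((p.1 - p'.1) ^ 2 + (p.2 - p'.2) ^ 2))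
    (hR : R ≤ 1) (hN : ((2 : ℝ) ^ N)⁻¹ ≤ R / 4) (hu : 0 ≤ u) (hq0 : 0 ≤ q) (hq1 : q < 1)
    (hx : 0 ≤ x) (hxu : x ≤ 2 * u - 4 * (q ^ N / (1 - q))) :
    μ.real {ω | u < supYOnSquare B a₁ a₂ R ω ∧ u < supYOnSquare B b₁ b₂ R ω} ≤
      μ.real (largeDyadicIncrement B q (T + 1) N) + ((⌊(T + 1) * 2 ^ N⌋₊ + 1 : ℕ) : ℝ) ^ 4 *
        exp (-x ^ 2 / (2 * (4 + 4 * ((2 : ℝ) ^ N)⁻¹ - (R / 4) ^ (2 * H)))) := by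
  set V := 4 + 4 * ((2 : ℝ) ^ N)⁻¹ - (R / 4) ^ (2 * H) with hV
  set M := ⌊(T + 1) * 2 ^ N⌋₊ + 1 with hM
  have hh : 0 < ((2 : ℝ) ^ N)⁻¹ := by positivity
  have hsep {a b : ℝ} (h : R ≤ Real.sqrt (a ^ 2 + b ^ 2)) : R / 2 ≤ |a| ∨ R / 2 ≤ |b| := by
    by_contra! hc
    have h1 := (Real.le_sqrt' (by linarith)).1 h
    have h2 := sq_lt_sq' (by linarith [abs_nonneg a]) hc.1
    have h3 := sq_lt_sq' (by linarith [abs_nonneg b]) hc.2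
    rw [sq_abs] at h2 h3
    nlinarith
  let ev : ℕ × ℕ × ℕ × ℕ → Set Ω := fun i => {ω |
    varAdd H (i.1 / 2 ^ N) (i.2.1 / 2 ^ N) (i.2.2.1 / 2 ^ N) (i.2.2.2 / 2 ^ N) ≤ V ∧
    x ≤ (B (i.1 / 2 ^ N) ω - B (i.2.1 / 2 ^ N) ω) +
      (B (i.2.2.1 / 2 ^ N) ω - B (i.2.2.2 / 2 ^ N) ω)}
  let F := Finset.range M ×ˢ Finset.range M ×ˢ Finset.range M ×ˢ Finset.range M
  have hev (i : ℕ × ℕ × ℕ × ℕ) : μ.real (ev i) ≤ exp (-x ^ 2 / (2 * V)) := by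
    by_cases hi : varAdd H (i.1 / 2 ^ N) (i.2.1 / 2 ^ N) (i.2.2.1 / 2 ^ N) (i.2.2.2 / 2 ^ N) ≤ V
    · simp only [ev, hi, true_and]
      exact hB.measureReal_add_ge_le hH.1 (by positivity) (by positivity) (by positivity)
        (by positivity) hx hi
    · simp only [ev, hi, false_and]
      simpa using (exp_pos _).le
  have hnull : μ.real {ω | ¬ Continuous fun t => B t ω} = 0 := by
    rw [measureReal_def, ae_iff.1 hB.ae_continuous, ENNReal.toReal_zero]
  have hsub : {ω | u < supYOnSquare B a₁ a₂ R ω ∧ u < supYOnSquare B b₁ b₂ R ω} ⊆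
      ({ω | ¬ Continuous fun t => B t ω} ∪ largeDyadicIncrement B q (T + 1) N) ∪
        ⋃ i ∈ F, ev i := by
    rintro ω ⟨h1, h2⟩
    by_contra hω
    simp only [mem_union, not_or] at hω
    obtain ⟨⟨hc, hinc⟩, hgrid⟩ := hω
    have hc : Continuous fun t => B t ω := by by_contra h; exact hc h
    simp only [largeDyadicIncrement, mem_ofPred_eq, not_exists, not_and, not_le] at hinc
    have happ {t : ℝ} (ht : 0 ≤ t) (htT : t ≤ T + 1) :=
      abs_le.1 (abs_sub_dyadicFloor_le hc hq0 hq1 (fun n hn j hj => (hinc n hn j hj).le) ht htT)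
    obtain ⟨t, ht, s, hs, hts⟩ := exists_lt_of_lt_supYOnSquare hu h1
    obtain ⟨t', ht', s', hs', hts'⟩ := exists_lt_of_lt_supYOnSquare hu h2
    obtain ⟨r1, r2, r3, r4⟩ := hA (mk_mem_prod ht hs)
    obtain ⟨r1', r2', r3', r4'⟩ := hA' (mk_mem_prod ht' hs')
    simp only at r1 r2 r3 r4 r1' r2' r3' r4'
    have k1 := happ (t := t) (by linarith) (by linarith)
    have k2 := happ (t := s) (by linarith) (by linarith)
    have k3 := happ (t := t') (by linarith) (by linarith)
    have k4 := happ (t := s') (by linarith) (by linarith)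
    have hidx {t : ℝ} (htT : t ≤ T + 1) : ⌊t * 2 ^ N⌋₊ < M := by
      rw [hM, Nat.lt_succ_iff]; gcongr
    refine hgrid ?_
    simp only [mem_iUnion]
    refine ⟨(⌊t * 2 ^ N⌋₊, ⌊s * 2 ^ N⌋₊, ⌊t' * 2 ^ N⌋₊, ⌊s' * 2 ^ N⌋₊), ?_, ?_⟩
    · simp only [F, Finset.mem_product, Finset.mem_range]
      exact ⟨hidx (by linarith), hidx (by linarith), hidx (by linarith), hidx (by linarith)⟩
    change varAdd H (dyadicFloor N t) (dyadicFloor N s) (dyadicFloor N t') (dyadicFloor N s') ≤ V ∧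
      x ≤ (B (dyadicFloor N t) ω - B (dyadicFloor N s) ω) +
        (B (dyadicFloor N t') ω - B (dyadicFloor N s') ω)
    have l1 := dyadicFloor_le N (t := t) (by linarith)
    have l2 := dyadicFloor_le N (t := s) (by linarith)
    have l3 := dyadicFloor_le N (t := t') (by linarith)
    have l4 := dyadicFloor_le N (t := s') (by linarith)
    have m1 := sub_lt_dyadicFloor N t
    have m2 := sub_lt_dyadicFloor N s
    have m3 := sub_lt_dyadicFloor N t'
    have m4 := sub_lt_dyadicFloor N s'
    have hround {a b a' b' : ℝ} (ha : R / 2 ≤ |a - b|) (h1 : a' ≤ a) (h2 : b' ≤ b)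
        (h3 : a - ((2 : ℝ) ^ N)⁻¹ < a') (h4 : b - ((2 : ℝ) ^ N)⁻¹ < b') : R / 4 ≤ |a' - b'| := by
      rcases le_abs.1 ha with h | h
      · exact le_abs.2 (Or.inl (by linarith))
      · exact le_abs.2 (Or.inr (by linarith))
    constructor
    · refine varAdd_le hH (by linarith) (by linarith) ⟨by linarith, by linarith⟩
        ⟨by linarith, by linarith⟩ hh.le ?_
      exact (hsep (hdist _ (mk_mem_prod ht hs) _ (mk_mem_prod ht' hs'))).imp
        (fun h => hround h l1 l3 m1 m3) (fun h => hround h l2 l4 m2 m4)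
    · linarith [k1.2, k2.1, k3.2, k4.1]
  calc _ ≤ μ.real _ := measureReal_mono hsub
    _ ≤ (μ.real {ω | ¬ Continuous fun t => B t ω} +
          μ.real (largeDyadicIncrement B q (T + 1) N)) + ∑ i ∈ F, μ.real (ev i) :=
        (measureReal_union_le _ _).trans
          (add_le_add (measureReal_union_le _ _) (measureReal_biUnion_finset_le _ _))
    _ ≤ _ := by
        rw [hnull, zero_add]
        gcongr
        refine (Finset.sum_le_sum fun i _ => hev i).trans_eq ?_
        simp only [Finset.sum_const, F, Finset.card_product, Finset.card_range, nsmul_eq_mul]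
        push_cast
        ring

theorem exists_le_stdNormalTail :
    ∃ c, 0 < c ∧ ∀ u : ℝ, 1 ≤ u → c * (exp (-u ^ 2 / 2) / u) ≤ stdNormalTail u := by
  refine ⟨(√(2 * π))⁻¹ * exp (-3 / 2), by positivity, fun u hu => ?_⟩
  have hu0 : 0 < u := by linarith
  set d := (√(2 * π))⁻¹ * exp (-(u + 1 / u) ^ 2 / 2) with hd
  have hpdf (x : ℝ) (hx : x ∈ Set.Ioc u (u + 1 / u)) : ENNReal.ofReal d ≤ gaussianPDF 0 1 x := by
    refine ENNReal.ofReal_le_ofReal ?_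
    simp only [gaussianPDFReal, hd, NNReal.coe_one, mul_one, sub_zero]
    gcongr
    · linarith [hx.1]
    · exact hx.2
  have h1 : ENNReal.ofReal (d * (1 / u)) ≤ gaussianReal 0 1 (Set.Ioi u) := by
    calc ENNReal.ofReal (d * (1 / u))
        = ∫⁻ _ in Set.Ioc u (u + 1 / u), ENNReal.ofReal d := by
          rw [setLIntegral_const, Real.volume_Ioc, add_sub_cancel_left,
            ENNReal.ofReal_mul (by positivity)]
      _ ≤ ∫⁻ x in Set.Ioc u (u + 1 / u), gaussianPDF 0 1 x :=
          setLIntegral_mono (measurable_gaussianPDF 0 1) hpdf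
      _ = gaussianReal 0 1 (Set.Ioc u (u + 1 / u)) := (gaussianReal_apply 0 one_ne_zero _).symm
      _ ≤ _ := measure_mono Set.Ioc_subset_Ioi_self
  have h2 := ENNReal.toReal_mono (measure_ne_top _ _) h1
  rw [ENNReal.toReal_ofReal (by positivity)] at h2
  refine le_trans ?_ h2
  rw [hd, mul_div_assoc', mul_one_div, mul_assoc, ← exp_add]
  gcongr
  have h3 : 1 / u ≤ 1 := by rw [div_le_one hu0]; exact hu
  have h4 : 0 < 1 / u := by positivity
  have h5 : u * (1 / u) = 1 := by field_simp
  nlinarith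

theorem eventually_rpow_mul_exp_neg_le (p r : ℝ) {C ε b κ : ℝ} (hε : 0 < ε) (hb : 0 < b)
    (hκ : 0 < κ) : ∀ᶠ u : ℝ in atTop, C * u ^ p * exp (-b * u ^ κ) ≤ ε * u ^ r := by
  have h := ((tendsto_rpow_mul_exp_neg_mul_atTop_nhds_zero ((p - r) / κ) b hb).comp
    (tendsto_rpow_atTop hκ)).const_mul C
  rw [mul_zero] at h
  filter_upwards [h.eventually_le_const hε, eventually_gt_atTop 0] with u hu hu0
  rw [Function.comp_apply, ← rpow_mul hu0.le, mul_div_cancel₀ _ hκ.ne', rpow_sub hu0] at hu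
  have hr : 0 < u ^ r := rpow_pos_of_pos hu0 r
  calc C * u ^ p * exp (-b * u ^ κ) = C * (u ^ p / u ^ r * exp (-b * u ^ κ)) * u ^ r := by
        field_simp
    _ ≤ ε * u ^ r := by gcongr

theorem eventually_log_sq_div_sq_le {δ : ℝ} (hδ : 0 < δ) :
    ∀ᶠ u : ℝ in atTop, Real.log u ^ 2 / u ^ 2 ≤ δ := by
  have h := Real.isLittleO_log_id_atTop.tendsto_div_nhds_zero.pow 2
  filter_upwards [h.eventually_le_const (u := δ) (by simpa using hδ)] with u hu
  simpa [div_pow] using hu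

/-- Exceedance level versus variance: the exponent in the Gaussian tail bound. -/
theorem exp_neg_sq_div_le {u w x V : ℝ} (hw1 : w ≤ 1) (hV0 : 0 < V)
    (hV : V ≤ 4 - w / 8) (hx : 4 * u ^ 2 - 1 ≤ x ^ 2) :
    exp (-x ^ 2 / (2 * V)) ≤ exp 1 * (exp (-u ^ 2 / 2) * exp (-(u ^ 2 * w / 64))) := by
  rw [← exp_add, ← exp_add, exp_le_exp, neg_div]
  have : u ^ 2 / 2 + u ^ 2 * w / 64 - 1 ≤ x ^ 2 / (2 * V) := by
    rw [le_div_iff₀ (by positivity)]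
    rcases le_total (u ^ 2 / 2 + u ^ 2 * w / 64 - 1) 0 with h | h
    · exact (mul_nonpos_of_nonpos_of_nonneg h (by positivity)).trans (sq_nonneg x)
    · calc _ ≤ (u ^ 2 / 2 + u ^ 2 * w / 64 - 1) * (2 * (4 - w / 8)) := by gcongr
        _ ≤ x ^ 2 := by nlinarith [mul_nonneg (sq_nonneg u) (sq_nonneg w)]
  linarith

set_option maxHeartbeats 400000 in
/-- Joint exceedance bound with an unspecified power of `u`. -/
theorem IsFractionalBrownianMotion.eventually_joint_exceedance_le {Ω : Type*} [MeasurableSpace Ω]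
    {μ : Measure Ω} [IsProbabilityMeasure μ] {H H' T : ℝ} {B : ℝ → Ω → ℝ}
    (hB : IsFractionalBrownianMotion μ H B) (hH : H ∈ Set.Ioo (0 : ℝ) (1 / 2))
    (hH' : H' ∈ Set.Ioo (2 * H) 1) (hT : 0 < T) :
    ∃ C p : ℝ, ∀ᶠ u : ℝ in atTop, ∀ a₁ a₂ b₁ b₂ : ℝ,
      Set.Icc a₁ (a₁ + u ^ (-(2:ℝ)/H')) ×ˢ Set.Icc a₂ (a₂ + u ^ (-(2:ℝ)/H')) ⊆
        sheppRegion T ((Real.log u)^2 / u^2) →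
      Set.Icc b₁ (b₁ + u ^ (-(2:ℝ)/H')) ×ˢ Set.Icc b₂ (b₂ + u ^ (-(2:ℝ)/H')) ⊆
        sheppRegion T ((Real.log u)^2 / u^2) →
      (∀ p ∈ Set.Icc a₁ (a₁ + u ^ (-(2:ℝ)/H')) ×ˢ Set.Icc a₂ (a₂ + u ^ (-(2:ℝ)/H')),
       ∀ q ∈ Set.Icc b₁ (b₁ + u ^ (-(2:ℝ)/H')) ×ˢ Set.Icc b₂ (b₂ + u ^ (-(2:ℝ)/H')),
        u ^ (-(2:ℝ)/H') ≤ Real.sqrt ((p.1 - q.1)^2 + (p.2 - q.2)^2)) →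
      (μ {ω | u < supYOnSquare B a₁ a₂ (u ^ (-(2:ℝ)/H')) ω ∧
              u < supYOnSquare B b₁ b₂ (u ^ (-(2:ℝ)/H')) ω}).toReal ≤
        C * u ^ p * exp (-(1 / 64) * u ^ (2 - 4 * H / H')) * stdNormalTail u := by
  obtain ⟨hH0, hH2⟩ := hH
  have hH'0 : 0 < H' := by linarith [hH'.1]
  obtain ⟨K, hK0, hK⟩ := hB.exists_measureReal_largeDyadicIncrement_le hH0
    (show 0 ≤ T + 1 by linarith)
  obtain ⟨c, hc0, hc⟩ := exists_le_stdNormalTail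
  set q : ℝ := 2 ^ (-H / 2) with hq
  have hq0 : 0 ≤ q := by positivity
  have hq1 : q < 1 := rpow_lt_one_of_one_lt_of_neg (by norm_num) (by linarith)
  have h1q : 0 < 1 - q := by linarith
  set D := 4 / (1 - q) with hD
  have hD0 : 0 < D := by positivity
  refine ⟨(K + (2 * (T + 2)) ^ 4 * exp 1) * c⁻¹, 16 / H + 1, ?_⟩
  filter_upwards [eventually_log_sq_div_sq_le (show (0 : ℝ) < 1 / 4 by norm_num),
    eventually_ge_atTop 2, eventually_ge_atTop (4 * D)] with u hlog hu2 huD a₁ a₂ b₁ b₂ hA hA' hdist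
  have hu0 : 0 < u := by linarith
  have hu1 : 1 ≤ u := by linarith
  set R := u ^ (-(2 : ℝ) / H') with hRdef
  set w := R ^ (2 * H) with hw
  have hR0 : 0 < R := by positivity
  have hR1 : R ≤ 1 := rpow_le_one_of_one_le_of_nonpos hu1 (by
    rw [neg_div]; exact neg_nonpos.2 (by positivity))
  have hw0 : 0 < w := by positivity
  have hw1 : w ≤ 1 := rpow_le_one hR0.le hR1 (by linarith)
  have huw : u ^ 2 * w = u ^ (2 - 4 * H / H') := by
    rw [hw, hRdef, ← rpow_mul hu0.le, ← rpow_two, ← rpow_add hu0]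
    congr 1
    ring
  have hx1 : 1 ≤ u ^ (4 / H) := one_le_rpow hu1 (by positivity)
  obtain ⟨n, hn1, hn2⟩ := exists_nat_pow_near hx1 (show (1 : ℝ) < 2 by norm_num)
  set N := n + 1 with hNdef
  have hN2 : (2 : ℝ) ^ N ≤ 2 * u ^ (4 / H) := by rw [hNdef, pow_succ]; linarith
  have hh : ((2 : ℝ) ^ N)⁻¹ ≤ u ^ (-(4 / H)) := by
    rw [rpow_neg hu0.le]
    exact inv_anti₀ (by positivity) hn2.le
  have hHinv : 2 < 1 / H := by rw [lt_div_iff₀ hH0]; linarith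
  have hH'inv : 1 / H' < 1 / (2 * H) := one_div_lt_one_div_of_lt (by linarith) hH'.1
  have hHH : 1 / (2 * H) = 1 / H / 2 := by field_simp
  have hNR : ((2 : ℝ) ^ N)⁻¹ ≤ R / 4 := by
    calc ((2 : ℝ) ^ N)⁻¹ ≤ u ^ (-(4 / H)) := hh
      _ ≤ u ^ (-(2 : ℝ) / H' - 2) := by
          refine rpow_le_rpow_of_exponent_le hu1 ?_
          have e1 : 4 / H = 4 * (1 / H) := by ring
          have e2 : -(2 : ℝ) / H' = -(2 * (1 / H')) := by ring
          rw [e1, e2]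
          linarith
      _ = R / u ^ 2 := by rw [rpow_sub hu0, rpow_two]
      _ ≤ R / 4 := by gcongr; nlinarith
  have hNw : 4 * ((2 : ℝ) ^ N)⁻¹ ≤ w / 8 := by
    have h6 : (64 : ℝ) ≤ u ^ 6 := by
      calc (64 : ℝ) = 2 ^ 6 := by norm_num
        _ ≤ u ^ 6 := by gcongr
    have : ((2 : ℝ) ^ N)⁻¹ ≤ w / 32 := by
      calc ((2 : ℝ) ^ N)⁻¹ ≤ u ^ (-(4 / H)) := hh
        _ ≤ u ^ (-(2 : ℝ) / H' * (2 * H) - (6 : ℕ)) := by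
            refine rpow_le_rpow_of_exponent_le hu1 ?_
            have e1 : 4 / H = 4 * (1 / H) := by ring
            have e2 : -(2 : ℝ) / H' * (2 * H) = -(2 * (2 * H / H')) := by ring
            have e3 : 2 * H / H' < 1 := by rw [div_lt_one hH'0]; exact hH'.1
            rw [e1, e2]
            push_cast
            linarith
        _ = w / u ^ 6 := by rw [rpow_sub hu0, rpow_natCast, rpow_mul hu0.le]
        _ ≤ w / 32 := by gcongr; linarith
    linarith
  have hR4 : w / 4 ≤ (R / 4) ^ (2 * H) := by
    rw [div_rpow hR0.le (by norm_num)]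
    gcongr
    calc (4 : ℝ) ^ (2 * H) ≤ 4 ^ (1 : ℝ) :=
          rpow_le_rpow_of_exponent_le (by norm_num) (by linarith)
      _ = 4 := rpow_one _
  have hR4' : (R / 4) ^ (2 * H) ≤ 1 := rpow_le_one (by positivity) (by linarith) (by linarith)
  have hqN : q ^ N ≤ 1 / u ^ 2 := by
    have e : q ^ N = ((2 : ℝ) ^ N) ^ (-(H / 2)) := by
      rw [hq, ← rpow_natCast _ N, ← rpow_natCast _ N, ← rpow_mul (by norm_num),
        ← rpow_mul (by norm_num)]
      congr 1
      ring
    have e' : u ^ 2 = (u ^ (4 / H)) ^ (H / 2) := by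
      rw [← rpow_mul hu0.le, ← rpow_two]
      congr 1
      field_simp
      norm_num
    rw [e, rpow_neg (by positivity), one_div, e']
    exact inv_anti₀ (by positivity) (rpow_le_rpow (by positivity) hn2.le (by positivity))
  have hDu : D / u ^ 2 ≤ 1 / (4 * u) := by
    rw [div_le_div_iff₀ (by positivity) (by positivity)]
    nlinarith
  have hu4 : 1 / (4 * u) ≤ 1 := by rw [div_le_one (by positivity)]; linarith
  have hxsq : 4 * u ^ 2 - 1 ≤ (2 * u - D / u ^ 2) ^ 2 := by
    have e : 4 * u * (1 / (4 * u)) = 1 := by field_simp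
    nlinarith [sq_nonneg (D / u ^ 2), mul_le_mul_of_nonneg_left hDu (show 0 ≤ 4 * u by linarith)]
  have hmain := hB.measureReal_joint_exceedance_le ⟨hH0, hH2⟩ hlog hA hA' hdist hR1 hNR hu0.le hq0
    hq1 (x := 2 * u - D / u ^ 2) (by linarith) (by
      have : 4 * (q ^ N / (1 - q)) ≤ D / u ^ 2 := by
        calc 4 * (q ^ N / (1 - q)) ≤ 4 * (1 / u ^ 2 / (1 - q)) := by gcongr
          _ = D / u ^ 2 := by rw [hD]; ring
      linarith)
  have hexp := exp_neg_sq_div_le (u := u) hw1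
    (show 0 < 4 + 4 * ((2 : ℝ) ^ N)⁻¹ - (R / 4) ^ (2 * H) by
      have : 0 < ((2 : ℝ) ^ N)⁻¹ := by positivity
      linarith) (by linarith) hxsq
  set E := exp (-u ^ 2 / 2) * exp (-(u ^ 2 * w / 64)) with hE
  have hbad : μ.real (largeDyadicIncrement B q (T + 1) N) ≤ K * E := by
    refine (hK N).trans (mul_le_mul_of_nonneg_left ?_ hK0)
    rw [hE, ← exp_add, exp_le_exp]
    have e : u ^ 4 ≤ ((2 : ℝ) ^ N) ^ H := by
      calc u ^ 4 = (u ^ (4 / H)) ^ H := by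
            rw [← rpow_mul hu0.le, div_mul_cancel₀ _ hH0.ne']
            exact_mod_cast (rpow_natCast u 4).symm
        _ ≤ _ := rpow_le_rpow (by positivity) hn2.le hH0.le
    have e1 : 4 * u ^ 2 ≤ u ^ 4 := by
      have : 4 ≤ u ^ 2 := by nlinarith
      nlinarith [mul_le_mul_of_nonneg_right this (sq_nonneg u)]
    have e2 : u ^ 2 * w ≤ u ^ 2 := mul_le_of_le_one_right (sq_nonneg u) hw1
    linarith [sq_nonneg u]
  have hM : ((⌊(T + 1) * 2 ^ N⌋₊ + 1 : ℕ) : ℝ) ≤ 2 * (T + 2) * u ^ (4 / H) := by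
    have h1 := Nat.floor_le (show 0 ≤ (T + 1) * 2 ^ N by positivity)
    have h2 : (1 : ℝ) ≤ 2 ^ N := one_le_pow₀ (by norm_num)
    have h3 := mul_le_mul_of_nonneg_left hN2 (show 0 ≤ T + 2 by linarith)
    push_cast
    linarith
  have hu16 : (u ^ (4 / H)) ^ 4 = u ^ (16 / H) := by
    rw [← rpow_natCast _ 4, ← rpow_mul hu0.le]
    congr 1
    push_cast
    ring
  have hEtail : E ≤ c⁻¹ * u * stdNormalTail u * exp (-(u ^ 2 * w / 64)) := by
    rw [hE]
    gcongr
    have := hc u hu1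
    rw [mul_assoc, ← div_le_iff₀' (by positivity), div_inv_eq_mul, ← div_le_iff₀' hu0]
    calc exp (-u ^ 2 / 2) * c / u = c * (exp (-u ^ 2 / 2) / u) := by ring
      _ ≤ _ := this
  calc _ ≤ _ := hmain
    _ ≤ K * E + (2 * (T + 2) * u ^ (4 / H)) ^ 4 * (exp 1 * E) := by gcongr
    _ = (K + (2 * (T + 2)) ^ 4 * exp 1 * u ^ (16 / H)) * E := by rw [mul_pow, hu16]; ring
    _ ≤ (K * u ^ (16 / H) + (2 * (T + 2)) ^ 4 * exp 1 * u ^ (16 / H)) * E := by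
        gcongr
        exact le_mul_of_one_le_right hK0 (one_le_rpow hu1 (by positivity))
    _ ≤ (K * u ^ (16 / H) + (2 * (T + 2)) ^ 4 * exp 1 * u ^ (16 / H)) *
          (c⁻¹ * u * stdNormalTail u * exp (-(u ^ 2 * w / 64))) := by gcongr
    _ = _ := by
        rw [rpow_add hu0, rpow_one, ← huw]
        ring_nf

/-- Double-sum bound: for distant `R_u`-squares `A, B` inside the relevant region
(`R_u = u^{-2/H'}`, `δ_u = (ln u)²/u²`), the joint exceedance probability satisfies
`P(max_A Y_H > u, max_B Y_H > u) ≤ C R_u² u^{4/H} exp(-c* u² R_u^{2H}) Ψ(u)`;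
in particular it is `o(u^a Ψ(u))` for every real `a`, uniformly in such squares. -/
theorem shepp_fbm_double_sum_bound
    {Ω : Type*} [MeasurableSpace Ω] (μ : Measure Ω) [IsProbabilityMeasure μ]
    (H : ℝ) (hH : H ∈ Set.Ioo (0:ℝ) (1/2))
    (B : ℝ → Ω → ℝ)
    (hmeas : ∀ t : ℝ, Measurable (B t))
    (hzero : ∀ ω, B 0 ω = 0)
    (hcont : ∀ᵐ ω ∂μ, Continuous fun t => B t ω)
    (hgauss : ∀ (n : ℕ) (c : Fin n → ℝ) (t : Fin n → ℝ),
      ∃ v : NNReal, μ.map (fun ω => ∑ i, c i * B (t i) ω) =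
        ProbabilityTheory.gaussianReal 0 v)
    (hcov : ∀ t s : ℝ, 0 ≤ t → 0 ≤ s →
      ∫ ω, B t ω * B s ω ∂μ = (t ^ (2*H) + s ^ (2*H) - |t - s| ^ (2*H)) / 2)
    (H' : ℝ) (hH' : H' ∈ Set.Ioo (2*H) 1) (T : ℝ) (hT : 0 < T) :
    (∃ C : ℝ, 0 < C ∧ ∃ cs : ℝ, 0 < cs ∧ ∀ᶠ u : ℝ in atTop,
      ∀ a₁ a₂ b₁ b₂ : ℝ,
        Set.Icc a₁ (a₁ + u ^ (-(2:ℝ)/H')) ×ˢ Set.Icc a₂ (a₂ + u ^ (-(2:ℝ)/H')) ⊆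
          sheppRegion T ((Real.log u)^2 / u^2) →
        Set.Icc b₁ (b₁ + u ^ (-(2:ℝ)/H')) ×ˢ Set.Icc b₂ (b₂ + u ^ (-(2:ℝ)/H')) ⊆
          sheppRegion T ((Real.log u)^2 / u^2) →
        (∀ p ∈ Set.Icc a₁ (a₁ + u ^ (-(2:ℝ)/H')) ×ˢ Set.Icc a₂ (a₂ + u ^ (-(2:ℝ)/H')),
         ∀ q ∈ Set.Icc b₁ (b₁ + u ^ (-(2:ℝ)/H')) ×ˢ Set.Icc b₂ (b₂ + u ^ (-(2:ℝ)/H')),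
          u ^ (-(2:ℝ)/H') ≤ Real.sqrt ((p.1 - q.1)^2 + (p.2 - q.2)^2)) →
        (μ {ω | u < supYOnSquare B a₁ a₂ (u ^ (-(2:ℝ)/H')) ω ∧
                u < supYOnSquare B b₁ b₂ (u ^ (-(2:ℝ)/H')) ω}).toReal ≤
          C * (u ^ (-(2:ℝ)/H'))^2 * u ^ (4/H) *
            Real.exp (-cs * u^2 * (u ^ (-(2:ℝ)/H')) ^ (2*H)) * stdNormalTail u) ∧
    (∀ a : ℝ, ∀ ε : ℝ, 0 < ε → ∀ᶠ u : ℝ in atTop,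
      ∀ a₁ a₂ b₁ b₂ : ℝ,
        Set.Icc a₁ (a₁ + u ^ (-(2:ℝ)/H')) ×ˢ Set.Icc a₂ (a₂ + u ^ (-(2:ℝ)/H')) ⊆
          sheppRegion T ((Real.log u)^2 / u^2) →
        Set.Icc b₁ (b₁ + u ^ (-(2:ℝ)/H')) ×ˢ Set.Icc b₂ (b₂ + u ^ (-(2:ℝ)/H')) ⊆
          sheppRegion T ((Real.log u)^2 / u^2) →
        (∀ p ∈ Set.Icc a₁ (a₁ + u ^ (-(2:ℝ)/H')) ×ˢ Set.Icc a₂ (a₂ + u ^ (-(2:ℝ)/H')),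
         ∀ q ∈ Set.Icc b₁ (b₁ + u ^ (-(2:ℝ)/H')) ×ˢ Set.Icc b₂ (b₂ + u ^ (-(2:ℝ)/H')),
          u ^ (-(2:ℝ)/H') ≤ Real.sqrt ((p.1 - q.1)^2 + (p.2 - q.2)^2)) →
        (μ {ω | u < supYOnSquare B a₁ a₂ (u ^ (-(2:ℝ)/H')) ω ∧
                u < supYOnSquare B b₁ b₂ (u ^ (-(2:ℝ)/H')) ω}).toReal ≤
          ε * u ^ a * stdNormalTail u) := by
  have hB : IsFractionalBrownianMotion μ H B := ⟨hmeas, hcont, hgauss, hcov⟩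
  obtain ⟨C, p, h⟩ := hB.eventually_joint_exceedance_le hH hH' hT
  have hH0 := hH.1
  have hH'0 : 0 < H' := by linarith [hH'.1]
  have hκ : 0 < 2 - 4 * H / H' := by
    have : 2 * H / H' < 1 := (div_lt_one hH'0).2 hH'.1
    have e : 4 * H / H' = 2 * (2 * H / H') := by ring
    linarith
  have htail (u : ℝ) : 0 ≤ stdNormalTail u := ENNReal.toReal_nonneg
  constructor
  · refine ⟨1, one_pos, 1 / 128, by norm_num, ?_⟩
    filter_upwards [h, eventually_rpow_mul_exp_neg_le p (-(2 : ℝ) / H' * 2 + 4 / H) (C := C)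
      one_pos (show (0 : ℝ) < 1 / 128 by norm_num) hκ, eventually_gt_atTop 0]
      with u hu hu' hu0 a₁ a₂ b₁ b₂ hA hA' hd
    refine (hu a₁ a₂ b₁ b₂ hA hA' hd).trans (mul_le_mul_of_nonneg_right ?_ (htail u))
    have e1 : u ^ 2 * (u ^ (-(2 : ℝ) / H')) ^ (2 * H) = u ^ (2 - 4 * H / H') := by
      rw [← rpow_mul hu0.le, ← rpow_two, ← rpow_add hu0]
      congr 1
      ring
    have e2 : (u ^ (-(2 : ℝ) / H')) ^ 2 * u ^ (4 / H) = u ^ (-(2 : ℝ) / H' * 2 + 4 / H) := by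
      rw [rpow_add hu0, rpow_mul hu0.le, rpow_two]
    rw [mul_assoc 1, e2, mul_assoc (-(1 / 128)), e1]
    have e3 : exp (-(1 / 64) * u ^ (2 - 4 * H / H')) = exp (-(1 / 128) * u ^ (2 - 4 * H / H')) *
        exp (-(1 / 128) * u ^ (2 - 4 * H / H')) := by
      rw [← exp_add]
      ring_nf
    rw [e3, ← mul_assoc]
    gcongr
  · intro a ε hε
    filter_upwards [h, eventually_rpow_mul_exp_neg_le p a (C := C) hε
      (show (0 : ℝ) < 1 / 64 by norm_num) hκ] with u hu hu' a₁ a₂ b₁ b₂ hA hA' hd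
    exact (hu a₁ a₂ b₁ b₂ hA hA' hd).trans (mul_le_mul_of_nonneg_right hu' (htail u))
end
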